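/- arXiv:1110.2630 — 2 statements merged into one kernel-verified Lean document; each statement's English description precedes it below -/
import Mathlib

section
/- Let N ≥ 1, let μ_1,…,μ_l ∈ ℂ be pairwise distinct and nonzero, and let n_1,…,n_l be positive integers with n_1 + … + n_l = N. Let o ∈ Mat_N(ℂ) be the block-diagonal matrix diag(μ_1·I_{n_1},…,μ_l·I_{n_l}) and let O = {g·o·g⁻¹ : g ∈ GL_N(ℂ)} be its conjugacy class. Let R = ℂ[x_{ij} : 1 ≤ i,j ≤ N] be the polynomial ring in the entries of the generic N×N matrix A = (x_{ij}). Then the ideal of R generated by the N² entries of the matrix polynomial (A − μ_1·1)(A − μ_2·1)⋯(A − μ_l·1) together with the N polynomials Tr(A^k) − Σ_{i=1}^l n_i μ_i^k (k = 1,…,N) equals the vanishing ideal of O, i.e. the ideal of all polynomials in R vanishing at every matrix B ∈ O. -/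
/-- The index set of `ℂ^N` partitioned into blocks of sizes `n 0, …, n (l-1)`
(so that `N = ∑ j, n j`). -/
abbrev BlockIdx (l : ℕ) (n : Fin l → ℕ) : Type := Σ j : Fin l, Fin (n j)

theorem Matrix.exists_algHom_conj_eq {K ι L S : Type*} [Field K] [Fintype ι]
    [DecidableEq ι] [CommRing L] [Algebra K L] [Algebra (MvPolynomial (ι × ι) K) L]
    [IsScalarTower K (MvPolynomial (ι × ι) K) L]
    [IsLocalization.Away (Matrix.mvPolynomialX ι ι K).det L] [CommRing S] [Algebra K S]
    (o : Matrix ι ι K) (u : (Matrix ι ι L)ˣ)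
    (hu : u.val = (algebraMap (MvPolynomial (ι × ι) K) L).mapMatrix (Matrix.mvPolynomialX ι ι K))
    (v : (Matrix ι ι S)ˣ) :
    ∃ ψ : L →ₐ[K] S,
      ψ.mapMatrix (u.val * o.map (algebraMap K L) * u⁻¹.val) =
        v.val * o.map (algebraMap K S) * v⁻¹.val ∧
      ∀ p : MvPolynomial (ι × ι) K,
        ψ (algebraMap _ L p) = MvPolynomial.aeval (fun q => v.val q.1 q.2) p := by
  have hev : (MvPolynomial.aeval fun q : ι × ι => v.val q.1 q.2).mapMatrix
      (Matrix.mvPolynomialX ι ι K) = v.val := by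
    ext i j
    simp [Matrix.mvPolynomialX]
  have hdet : IsUnit (MvPolynomial.aeval (R := K) (fun q : ι × ι => v.val q.1 q.2)
      (Matrix.mvPolynomialX ι ι K).det) := by
    rw [AlgHom.map_det, hev]
    exact (Matrix.isUnit_iff_isUnit_det _).1 v.isUnit
  obtain ⟨ψ, hψ⟩ : ∃ ψ : L →ₐ[K] S, ∀ p : MvPolynomial (ι × ι) K,
      ψ (algebraMap _ L p) = MvPolynomial.aeval (fun q => v.val q.1 q.2) p :=
    ⟨IsLocalization.Away.liftAlgHom (Matrix.mvPolynomialX ι ι K).det hdet, fun p => by simp⟩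
  refine ⟨ψ, ?_, hψ⟩
  have huv : ψ.mapMatrix u.val = v.val := by
    rw [← hev, hu]
    ext i j
    simp [hψ]
  have huv' : ψ.mapMatrix u⁻¹.val = v⁻¹.val := by
    rw [← Units.mul_right_inj v, v.mul_inv, ← huv, ← map_mul, u.mul_inv, map_one]
  have ho : ψ.mapMatrix (o.map (algebraMap K L)) = o.map (algebraMap K S) := by
    ext i j
    simp
  rw [map_mul, map_mul, huv, huv', ho]

theorem MvPolynomial.aeval_mapMatrix_apply {K ι L S : Type*} [CommSemiring K] [Fintype ι]
    [DecidableEq ι] [CommSemiring L] [Algebra K L] [CommSemiring S] [Algebra K S] (ψ : L →ₐ[K] S)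
    (M : Matrix ι ι L) (f : MvPolynomial (ι × ι) K) :
    MvPolynomial.aeval (fun q : ι × ι => ψ.mapMatrix M q.1 q.2) f =
      ψ (MvPolynomial.aeval (fun q : ι × ι => M q.1 q.2) f) :=
  (MvPolynomial.comp_aeval_apply (fun q : ι × ι => M q.1 q.2) ψ f).symm

theorem MvPolynomial.aeval_conj_eq_zero {K ι T : Type*} [Field K] [Infinite K] [Fintype ι]
    [DecidableEq ι] [CommRing T] [Algebra K T] (o : Matrix ι ι K) (f : MvPolynomial (ι × ι) K)
    (hf : ∀ g : (Matrix ι ι K)ˣ, MvPolynomial.aeval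
      (fun q : ι × ι => (g.val * o * g⁻¹.val) q.1 q.2) f = 0)
    (g : (Matrix ι ι T)ˣ) :
    MvPolynomial.aeval
      (fun q : ι × ι => (g.val * o.map (algebraMap K T) * g⁻¹.val) q.1 q.2) f = 0 := by
  let d := (Matrix.mvPolynomialX ι ι K).det
  let L := Localization.Away d
  have hL : IsUnit ((algebraMap (MvPolynomial (ι × ι) K) L).mapMatrix
      (Matrix.mvPolynomialX ι ι K)) := by
    rw [Matrix.isUnit_iff_isUnit_det, ← RingHom.map_det]
    exact IsLocalization.Away.algebraMap_isUnit d
  obtain ⟨u, hu⟩ := hL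
  suffices h : MvPolynomial.aeval
      (fun q : ι × ι => (u.val * o.map (algebraMap K L) * u⁻¹.val) q.1 q.2) f = 0 by
    obtain ⟨ψ, hψ, -⟩ := Matrix.exists_algHom_conj_eq o u hu g
    rw [← hψ, MvPolynomial.aeval_mapMatrix_apply, h, map_zero]
  obtain ⟨k, p, hp⟩ := IsLocalization.Away.surj d (MvPolynomial.aeval
      (fun q : ι × ι => (u.val * o.map (algebraMap K L) * u⁻¹.val) q.1 q.2) f)
  have hpd : p * d = 0 := by
    refine MvPolynomial.funext fun x => ?_
    rw [map_mul, map_zero]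
    by_cases hx : MvPolynomial.eval x d = 0
    · rw [hx, mul_zero]
    have hX : IsUnit (Matrix.of fun i j => x (i, j)) := by
      rw [Matrix.isUnit_iff_isUnit_det, isUnit_iff_ne_zero]
      convert hx
      rw [RingHom.map_det]
      congr 1
      ext i j
      simp [Matrix.mvPolynomialX]
    obtain ⟨v, hv⟩ := hX
    obtain ⟨ψ, hψ, hψ'⟩ := Matrix.exists_algHom_conj_eq o u hu v
    have h0 : ψ (MvPolynomial.aeval
        (fun q : ι × ι => (u.val * o.map (algebraMap K L) * u⁻¹.val) q.1 q.2) f) = 0 := by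
      rw [← MvPolynomial.aeval_mapMatrix_apply, hψ]
      exact hf v
    have h1 := congr_arg ψ hp
    rw [map_mul, h0, zero_mul, hψ', hv] at h1
    have : MvPolynomial.eval x p = 0 := h1.symm
    rw [this, zero_mul]
  have hp0 : p = 0 :=
    (mul_eq_zero.1 hpd).resolve_right (Matrix.det_mvPolynomialX_ne_zero ι K)
  rw [hp0, map_zero] at hp
  exact ((IsLocalization.Away.algebraMap_isUnit (S := L) d).pow k).mul_left_eq_zero.1 hp

theorem LinearMap.exists_basis_of_completeOrthogonalIdempotents {κ T M : Type*} [Fintype κ]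
    [CommRing T] [IsLocalRing T] [CharZero T] [AddCommGroup M] [Module T M] [Module.Free T M]
    [Module.Finite T M] {e : κ → Module.End T M} (he : CompleteOrthogonalIdempotents e)
    {n : κ → ℕ} (htr : ∀ j, LinearMap.trace T M (e j) = n j) :
    ∃ b : Module.Basis (Σ j, Fin (n j)) T M, ∀ x, e x.1 (b x) = b x := by
  classical
  have hint : DirectSum.IsInternal fun j => LinearMap.range (e j) := by
    refine DirectSum.isInternal_submodule_of_iSupIndep_of_iSup_eq_top ?_ ?_
    · intro i
      rw [Submodule.disjoint_def]
      rintro _ ⟨x, rfl⟩ hx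
      have hle : ⨆ j, ⨆ (_ : j ≠ i), LinearMap.range (e j) ≤ LinearMap.ker (e i) := by
        refine iSup₂_le fun j hj => ?_
        rintro _ ⟨y, rfl⟩
        exact LinearMap.congr_fun (he.ortho hj.symm) y
      have := hle hx
      rwa [LinearMap.mem_ker, ← Module.End.mul_apply, (he.idem i).eq] at this
    · rw [eq_top_iff]
      rintro x -
      have hx : x = ∑ j, e j x := by
        rw [← LinearMap.sum_apply, he.complete, Module.End.one_apply]
      rw [hx]
      exact Submodule.sum_mem _ fun j _ => Submodule.mem_iSup_of_mem j ⟨x, rfl⟩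
  have hproj : ∀ f : Module.End T M, IsIdempotentElem f → Module.Free T (LinearMap.range f) := by
    intro f hf
    have : Module.Projective T (LinearMap.range f) :=
      Module.Projective.of_split (LinearMap.range f).subtype f.rangeRestrict (by
        ext ⟨_, y, rfl⟩
        exact LinearMap.congr_fun hf.eq y)
    exact Module.free_of_flat_of_isLocalRing
  have hfree : ∀ j, Module.Free T (LinearMap.range (e j)) := fun j => hproj _ (he.idem j)
  have hrank : ∀ j, Module.finrank T (LinearMap.range (e j)) = n j := by
    intro j
    have hker : LinearMap.ker (e j) = LinearMap.range (1 - e j) :=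
      LinearMap.IsIdempotentElem.ker_eq_range (he.idem j)
    have : Module.Free T (LinearMap.ker (e j)) := hker ▸ hproj _ (he.idem j).one_sub
    have : Module.Finite T (LinearMap.ker (e j)) := hker ▸ inferInstance
    have h := (LinearMap.IsIdempotentElem.isProj_range _ (he.idem j)).trace
    rw [htr] at h
    exact_mod_cast h.symm
  refine ⟨hint.collectedBasis fun j => Module.finBasisOfFinrankEq T _ (hrank j), fun x => ?_⟩
  rw [DirectSum.IsInternal.collectedBasis_coe]
  exact (LinearMap.IsIdempotentElem.mem_range_iff (he.idem x.1)).1 (Subtype.mem _)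

open Polynomial in
theorem Polynomial.completeOrthogonalIdempotents_aeval_lagrangeBasis {K κ E : Type*} [Field K]
    [Fintype κ] [Nonempty κ] [DecidableEq κ] [Ring E] [Algebra K E] {μ : κ → K}
    (hμ : Function.Injective μ) {B : E} (hB : aeval B (Lagrange.nodal Finset.univ μ) = 0) :
    CompleteOrthogonalIdempotents fun j => aeval B (Lagrange.basis Finset.univ μ j) := by
  rw [CompleteOrthogonalIdempotents.iff_ortho_complete]
  constructor
  · intro i j hij
    obtain ⟨r, hr⟩ : Lagrange.nodal Finset.univ μ ∣
        Lagrange.basis Finset.univ μ i * Lagrange.basis Finset.univ μ j := by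
      rw [Lagrange.nodal_eq]
      refine Finset.prod_dvd_of_coprime
        (fun a _ b _ hab => isCoprime_X_sub_C_of_isUnit_sub
          (sub_ne_zero.2 (hμ.ne hab)).isUnit) fun k _ => ?_
      rw [dvd_iff_isRoot, IsRoot, eval_mul]
      by_cases hk : i = k
      · subst hk
        rw [Lagrange.eval_basis_of_ne hij.symm (Finset.mem_univ _), mul_zero]
      · rw [Lagrange.eval_basis_of_ne hk (Finset.mem_univ _), zero_mul]
    rw [← map_mul, hr, map_mul, hB, zero_mul]
  · rw [← map_sum, Lagrange.sum_basis hμ.injOn Finset.univ_nonempty, map_one]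

open Polynomial in
theorem Polynomial.mul_aeval_lagrangeBasis {K κ E : Type*} [Field K]
    [Fintype κ] [DecidableEq κ] [Ring E] [Algebra K E] {μ : κ → K}
    {B : E} (hB : aeval B (Lagrange.nodal Finset.univ μ) = 0) (j : κ) :
    B * aeval B (Lagrange.basis Finset.univ μ j) =
      μ j • aeval B (Lagrange.basis Finset.univ μ j) := by
  have h : aeval B ((X - C (μ j)) * Lagrange.basis Finset.univ μ j) = 0 := by
    rw [Lagrange.basis_eq_prod_sub_inv_mul_nodal_div (Finset.mem_univ j),
      ← Lagrange.nodal_erase_eq_nodal_div (Finset.mem_univ j), mul_left_comm,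
      ← Lagrange.nodal_eq_mul_nodal_erase (Finset.mem_univ j), map_mul, hB, mul_zero]
  rw [map_mul, map_sub, aeval_X, aeval_C, sub_mul, sub_eq_zero] at h
  rw [h, Algebra.smul_def]

open Polynomial in
theorem Matrix.trace_mul_aeval_eq_sum {K κ ι T : Type*} [Field K] [Fintype κ] [Fintype ι]
    [DecidableEq ι] [CommRing T] [Algebra K T] {n : κ → ℕ} {μ : κ → K} {N : ℕ}
    {B : Matrix ι ι T} (htr : ∀ m < N, (B ^ (m + 1)).trace =
      algebraMap K T (∑ j, (n j : K) * μ j ^ (m + 1))) {p : K[X]} (hp : p.natDegree < N) :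
    (B * aeval B p).trace = algebraMap K T (∑ j, (n j : K) * (μ j * p.eval (μ j))) := by
  rw [aeval_eq_sum_range' hp, Finset.mul_sum, Matrix.trace_sum]
  simp only [eval_eq_sum_range' hp, Finset.mul_sum]
  rw [Finset.sum_comm, map_sum]
  refine Finset.sum_congr rfl fun m hm => ?_
  rw [mul_smul_comm, Matrix.trace_smul, ← pow_succ', htr m (Finset.mem_range.1 hm),
    Algebra.smul_def, ← map_mul, Finset.mul_sum]
  congr 1
  refine Finset.sum_congr rfl fun j _ => ?_
  ring

open Polynomial in
theorem Matrix.trace_aeval_lagrangeBasis {K κ ι T : Type*} [Field K] [Fintype κ] [Fintype ι]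
    [DecidableEq κ] [DecidableEq ι] [CommRing T] [Algebra K T] {n : κ → ℕ} {μ : κ → K} {N : ℕ}
    (hμ0 : ∀ j, μ j ≠ 0) (hμ : Function.Injective μ) (hN : Fintype.card κ ≤ N)
    {B : Matrix ι ι T} (hB : aeval B (Lagrange.nodal Finset.univ μ) = 0)
    (htr : ∀ m < N, (B ^ (m + 1)).trace =
      algebraMap K T (∑ j, (n j : K) * μ j ^ (m + 1))) (j : κ) :
    (aeval B (Lagrange.basis Finset.univ μ j)).trace = (n j : T) := by
  have hdeg : (Lagrange.basis Finset.univ μ j).natDegree < N := by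
    rw [Lagrange.natDegree_basis hμ.injOn (Finset.mem_univ j), Finset.card_univ]
    have := Fintype.card_pos_iff.2 ⟨j⟩
    omega
  have h := Matrix.trace_mul_aeval_eq_sum htr hdeg
  rw [Polynomial.mul_aeval_lagrangeBasis hB, Matrix.trace_smul, Finset.sum_eq_single j,
    Lagrange.eval_basis_self hμ.injOn (Finset.mem_univ j), mul_one, mul_comm, map_mul,
    ← Algebra.smul_def, map_natCast] at h
  · exact (smul_right_inj (hμ0 j)).1 h
  · intro k _ hk
    rw [Lagrange.eval_basis_of_ne hk.symm (Finset.mem_univ k), mul_zero, mul_zero]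
  · exact fun h => absurd (Finset.mem_univ j) h

open Polynomial Matrix in
theorem Matrix.exists_eq_conj_diagonal {K κ T : Type*} [Field K] [CharZero K] [Fintype κ]
    [Nonempty κ] [DecidableEq κ] [CommRing T] [IsLocalRing T] [Algebra K T] {n : κ → ℕ}
    {μ : κ → K} {N : ℕ} (hμ0 : ∀ j, μ j ≠ 0) (hμ : Function.Injective μ)
    (hN : Fintype.card κ ≤ N) {B : Matrix (Σ j, Fin (n j)) (Σ j, Fin (n j)) T}
    (hB : aeval B (Lagrange.nodal Finset.univ μ) = 0)
    (htr : ∀ m < N, (B ^ (m + 1)).trace =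
      algebraMap K T (∑ j, (n j : K) * μ j ^ (m + 1))) :
    ∃ g : (Matrix (Σ j, Fin (n j)) (Σ j, Fin (n j)) T)ˣ,
      B = g.val * (Matrix.diagonal fun x => μ x.1).map (algebraMap K T) * g⁻¹.val := by
  have : CharZero T := charZero_of_injective_algebraMap (algebraMap K T).injective
  have he := (Polynomial.completeOrthogonalIdempotents_aeval_lagrangeBasis hμ hB).map
    (Matrix.toLinAlgEquiv' : Matrix (Σ j, Fin (n j)) (Σ j, Fin (n j)) T ≃ₐ[T] _).toRingHom
  obtain ⟨b, hb⟩ := LinearMap.exists_basis_of_completeOrthogonalIdempotents he (n := n)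
    fun j => by
      rw [← Matrix.trace_aeval_lagrangeBasis hμ0 hμ hN hB htr j]
      exact Matrix.trace_toLin'_eq _
  let g : (Matrix (Σ j, Fin (n j)) (Σ j, Fin (n j)) T)ˣ :=
    ⟨(Pi.basisFun T _).toMatrix b, b.toMatrix (Pi.basisFun T _),
      Module.Basis.toMatrix_mul_toMatrix_flip _ _, Module.Basis.toMatrix_mul_toMatrix_flip _ _⟩
  refine ⟨g, ?_⟩
  rw [Units.eq_mul_inv_iff_mul_eq]
  have hBb : ∀ x, B *ᵥ b x = μ x.1 • b x := by
    intro x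
    have hx : aeval B (Lagrange.basis Finset.univ μ x.1) *ᵥ b x = b x := hb x
    rw [← hx, Matrix.mulVec_mulVec, Polynomial.mul_aeval_lagrangeBasis hB, Matrix.smul_mulVec]
  ext i x
  rw [Matrix.diagonal_map (map_zero _), Matrix.mul_diagonal]
  have h := congr_fun (hBb x) i
  rw [Pi.smul_apply, Algebra.smul_def, mul_comm] at h
  exact h

open Polynomial in
theorem Matrix.prod_ofFn_sub_smul_one {K ι T : Type*} [Field K] [Fintype ι] [DecidableEq ι]
    [CommRing T] [Algebra K T] {l : ℕ} (μ : Fin l → K) (B : Matrix ι ι T) :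
    (List.ofFn fun j : Fin l => B - algebraMap K T (μ j) • 1).prod =
      aeval B (Lagrange.nodal Finset.univ μ) := by
  rw [Lagrange.nodal_eq, ← List.prod_ofFn, map_list_prod, List.map_ofFn]
  congr 2
  funext j
  simp [Algebra.algebraMap_eq_smul_one]

theorem Polynomial.aeval_diagonal {K ι : Type*} [Field K] [Fintype ι] [DecidableEq ι]
    (d : ι → K) (p : Polynomial K) :
    Polynomial.aeval (Matrix.diagonal d) p = Matrix.diagonal fun i => p.eval (d i) := by
  induction p using Polynomial.induction_on' with
  | add p q hp hq => simp [hp, hq, Matrix.diagonal_add]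
  | monomial m a =>
    simp [Polynomial.aeval_monomial, Matrix.diagonal_pow, Matrix.algebraMap_eq_diagonal,
      Matrix.diagonal_mul_diagonal]

theorem Polynomial.aeval_units_conj {K E : Type*} [CommSemiring K] [Semiring E] [Algebra K E]
    (g : Eˣ) (x : E) (p : Polynomial K) :
    Polynomial.aeval (g.val * x * g⁻¹.val) p = g.val * Polynomial.aeval x p * g⁻¹.val := by
  induction p using Polynomial.induction_on' with
  | add p q hp hq => simp [hp, hq, mul_add, add_mul]
  | monomial m a =>
    rw [Polynomial.aeval_monomial, Polynomial.aeval_monomial, Units.conj_pow,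
      ← mul_assoc, ← mul_assoc, Algebra.commutes a g.val, ← mul_assoc, mul_assoc g.val]

theorem Ideal.mem_of_forall_algHom_isLocalRing.{u} {K : Type*} {P : Type u} [CommRing K]
    [CommRing P] [Algebra K P] {I : Ideal P} {f : P}
    (h : ∀ (T : Type u) [CommRing T] [IsLocalRing T] [Algebra K T] (φ : P →ₐ[K] T),
      (∀ p ∈ I, φ p = 0) → φ f = 0) : f ∈ I := by
  rw [← Ideal.Quotient.eq_zero_iff_mem]
  refine eq_zero_of_localization _ fun J hJ => ?_
  refine h (Localization.AtPrime J)
    ((IsScalarTower.toAlgHom K (P ⧸ I) (Localization.AtPrime J)).comp (Ideal.Quotient.mkₐ K I))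
    fun p hp => ?_
  have hp0 : Ideal.Quotient.mkₐ K I p = 0 := Ideal.Quotient.eq_zero_iff_mem.2 hp
  rw [AlgHom.comp_apply, hp0, map_zero]

/-- the ideal generated by the entries of `(A−μ_1)⋯(A−μ_l)` and the trace
relations `Tr(A^k) = Σ n_i μ_i^k`, `k = 1,…,N`, is the vanishing ideal of the conjugacy
class of `o = diag(μ_1·I_{n_1},…,μ_l·I_{n_l})` in `GL_N(ℂ)`. -/
theorem gl_conjugacy_class_defining_ideal
    (N : ℕ) (hN : 1 ≤ N) (l : ℕ) (n : Fin l → ℕ) (hn : ∀ j, 0 < n j)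
    (hsum : ∑ j, n j = N)
    (μ : Fin l → ℂ) (hμ0 : ∀ j, μ j ≠ 0) (hμ : Function.Injective μ) :
    let o : Matrix (BlockIdx l n) (BlockIdx l n) ℂ := Matrix.diagonal fun x => μ x.1
    let O : Set (Matrix (BlockIdx l n) (BlockIdx l n) ℂ) :=
      {B | ∃ g : (Matrix (BlockIdx l n) (BlockIdx l n) ℂ)ˣ,
        B = (g : Matrix (BlockIdx l n) (BlockIdx l n) ℂ) * o *
          ((g⁻¹ : (Matrix (BlockIdx l n) (BlockIdx l n) ℂ)ˣ) :
            Matrix (BlockIdx l n) (BlockIdx l n) ℂ)}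
    let A : Matrix (BlockIdx l n) (BlockIdx l n)
        (MvPolynomial (BlockIdx l n × BlockIdx l n) ℂ) :=
      Matrix.of fun i j => MvPolynomial.X (i, j)
    let FA : Matrix (BlockIdx l n) (BlockIdx l n)
        (MvPolynomial (BlockIdx l n × BlockIdx l n) ℂ) :=
      (List.ofFn fun j : Fin l => A - (MvPolynomial.C (μ j) : MvPolynomial (BlockIdx l n × BlockIdx l n) ℂ) • 1).prod
    Ideal.span
        ((Set.range fun q : BlockIdx l n × BlockIdx l n => FA q.1 q.2) ∪
          (Set.range fun m : Fin N =>
            Matrix.trace (A ^ ((m : ℕ) + 1)) -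
              MvPolynomial.C (∑ j, (n j : ℂ) * μ j ^ ((m : ℕ) + 1))))
      = MvPolynomial.vanishingIdeal ℂ
          ((fun (B : Matrix (BlockIdx l n) (BlockIdx l n) ℂ)
              (q : BlockIdx l n × BlockIdx l n) => B q.1 q.2) '' O) := by
  intro o O A FA
  have hFA : FA = Polynomial.aeval A (Lagrange.nodal Finset.univ μ) :=
    Matrix.prod_ofFn_sub_smul_one μ A
  have hl : l ≤ N := by
    rw [← hsum]
    simpa using Finset.card_nsmul_le_sum Finset.univ n 1 fun j _ => hn j
  apply le_antisymm
  · rw [Ideal.span_le]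
    rintro _ (⟨q, rfl⟩ | ⟨m, rfl⟩) <;> rintro _ ⟨_, ⟨g, rfl⟩, rfl⟩
    all_goals
      set φ : MvPolynomial (BlockIdx l n × BlockIdx l n) ℂ →ₐ[ℂ] ℂ := MvPolynomial.aeval
        fun q : BlockIdx l n × BlockIdx l n => (g.val * o * g⁻¹.val) q.1 q.2 with hφ
      have hA : φ.mapMatrix A = g.val * o * g⁻¹.val := by
        ext i j
        simp [A, hφ]
    · have h : φ.mapMatrix FA = 0 := by
        rw [hFA, ← Polynomial.aeval_algHom_apply, hA, Polynomial.aeval_units_conj,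
          Polynomial.aeval_diagonal]
        simp [Lagrange.eval_nodal_at_node]
      exact congr_fun₂ h q.1 q.2
    · have h : φ (A ^ (m.val + 1)).trace = ∑ j, (n j : ℂ) * μ j ^ (m.val + 1) := by
        rw [AddMonoidHom.map_trace φ, ← AlgHom.mapMatrix_apply, map_pow, hA, Units.conj_pow,
          Matrix.trace_units_conj, Matrix.diagonal_pow, Matrix.trace_diagonal,
          Fintype.sum_sigma]
        simp
      change φ _ = 0
      rw [map_sub, h, ← MvPolynomial.algebraMap_eq, AlgHom.commutes]
      exact sub_self _
  · intro f hf
    have hne : Nonempty (Fin l) := by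
      by_contra h
      rw [not_nonempty_iff] at h
      simp at hsum
      omega
    refine Ideal.mem_of_forall_algHom_isLocalRing (K := ℂ) fun T _ _ _ φ hφ => ?_
    have hB : Polynomial.aeval (φ.mapMatrix A) (Lagrange.nodal Finset.univ μ) = 0 := by
      rw [Polynomial.aeval_algHom_apply, ← hFA]
      ext i j
      exact hφ _ (Ideal.subset_span (Or.inl ⟨(i, j), rfl⟩))
    have htr : ∀ m < N, (φ.mapMatrix A ^ (m + 1)).trace =
        algebraMap ℂ _ (∑ j, (n j : ℂ) * μ j ^ (m + 1)) := by
      intro m hm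
      have h := hφ _ (Ideal.subset_span (Or.inr ⟨⟨m, hm⟩, rfl⟩))
      rw [map_sub, sub_eq_zero, ← MvPolynomial.algebraMap_eq, AlgHom.commutes,
        AddMonoidHom.map_trace φ, ← AlgHom.mapMatrix_apply, map_pow] at h
      exact h
    obtain ⟨g, hg⟩ := Matrix.exists_eq_conj_diagonal hμ0 hμ
      (hN := (Fintype.card_fin l).trans_le hl) hB htr
    have h0 := MvPolynomial.aeval_conj_eq_zero o f
      (fun g => hf _ ⟨_, ⟨g, rfl⟩, rfl⟩) g
    rw [← hg, MvPolynomial.aeval_mapMatrix_apply] at h0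
    rwa [show MvPolynomial.aeval (fun q : BlockIdx l n × BlockIdx l n => A q.1 q.2) f = f from
      MvPolynomial.aeval_X_left_apply f] at h0
end

section
/- Let n ≥ 1 and let C ∈ Mat_{2n}(ℂ) be the skew-symmetric matrix C_{ij} = ε_i δ_{i,2n+1−j}, where ε_i = 1 for 1 ≤ i ≤ n and ε_i = −1 for n+1 ≤ i ≤ 2n. Let G = Sp(2n,ℂ) = {A ∈ Mat_{2n}(ℂ) : A C Aᵀ = C}. Fix integers ℓ ≥ 0, m ≥ 1, p ≥ 1 and positive integers n_1,…,n_ℓ with n_1+…+n_ℓ+m+p = n, and complex numbers μ_1,…,μ_ℓ with μ_i ≠ 0, μ_i² ≠ 1, and μ_i ∉ {μ_j, μ_j⁻¹} for i ≠ j. Let o ∈ G be the diagonal matrix with diagonal entries (μ_1 repeated n_1 times, …, μ_ℓ repeated n_ℓ times, −1 repeated m times, 1 repeated 2p times, −1 repeated m times, μ_ℓ⁻¹ repeated n_ℓ times, …, μ_1⁻¹ repeated n_1 times), and let O = {g·o·g⁻¹ : g ∈ G} be its conjugacy class. Let R = ℂ[x_{ij} : 1 ≤ i,j ≤ 2n]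 with generic matrix A = (x_{ij}). Then the ideal of R generated by: (a) the (2n)² entries of A C Aᵀ − C, (b) the (2n)² entries of (A − μ_1)⋯(A − μ_ℓ)(A + 1)(A − 1)(A − μ_ℓ⁻¹)⋯(A − μ_1⁻¹), and (c) the 2n polynomials Tr(A^k) − (Σ_{i=1}^ℓ n_i(μ_i^k + μ_i^{−k}) + 2m(−1)^k + 2p) for k = 1,…,2n, equals the vanishing ideal of O, i.e. the ideal of all polynomials in R vanishing at every matrix B ∈ O. -/
open Matrix

namespace SpConj

open Polynomial in
theorem exists_polynomial_dvd_sq_sub_X {p : ℂ[X]} (hp : p.eval 0 ≠ 0) :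
    ∃ q : ℂ[X], p ∣ q ^ 2 - X := by
  have hp0 : p ≠ 0 := by rintro rfl; simp at hp
  choose s hs using fun z : ℂ => IsAlgClosed.exists_pow_nat_eq z (n := 2) (by norm_num)
  let q₀ : ℂ[X] := Lagrange.interpolate p.roots.toFinset id s
  have hq₀ : ∀ z, p.IsRoot z → q₀.eval z ^ 2 = z := fun z hz => by
    have : q₀.eval (id z) = s z := Lagrange.eval_interpolate_at_node s (Function.injective_id.injOn)
      (by simpa [hp0] using hz)
    rw [id] at this
    rw [this, hs]
  have hdvd : p ∣ (q₀ ^ 2 - X) ^ p.natDegree := by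
    have key : ∀ m : Multiset ℂ, m ≤ p.roots →
        (m.map fun a => X - C a).prod ∣ (q₀ ^ 2 - X) ^ m.card := fun m => by
      induction m using Multiset.induction with
      | empty => simp
      | cons a m ih =>
        intro hm
        rw [Multiset.map_cons, Multiset.prod_cons, Multiset.card_cons, pow_succ']
        refine mul_dvd_mul ?_ (ih ((Multiset.le_cons_self _ _).trans hm))
        rw [dvd_iff_isRoot, IsRoot.def, eval_sub, eval_pow, eval_X, hq₀ a, sub_self]
        exact isRoot_of_mem_roots (Multiset.mem_of_le hm (Multiset.mem_cons_self _ _))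
    have hsplit := IsAlgClosed.splits p
    rw [hsplit.natDegree_eq_card_roots]
    conv_lhs => rw [hsplit.eq_prod_roots]
    exact (isUnit_C.2 (isUnit_iff_ne_zero.2 (leadingCoeff_ne_zero.2 hp0))).mul_left_dvd.2
      (key _ le_rfl)
  have hunit : IsUnit (AdjoinRoot.mk p q₀) := by
    have hco : IsCoprime p q₀ := by
      rw [isCoprime_iff_aeval_ne_zero_of_isAlgClosed ℂ ℂ]
      intro z
      by_contra! h
      simp only [coe_aeval_eq_eval] at h
      have := hq₀ z h.1
      rw [h.2, zero_pow two_ne_zero] at this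
      exact hp (this ▸ h.1)
    obtain ⟨a, b, hab⟩ := hco
    refine IsUnit.of_mul_eq_one (AdjoinRoot.mk p b) ?_
    rw [← map_mul, mul_comm, ← map_one (AdjoinRoot.mk p), AdjoinRoot.mk_eq_mk, ← hab]
    exact ⟨-a, by ring⟩
  obtain ⟨r, ⟨-, hr⟩, -⟩ := existsUnique_nilpotent_sub_and_aeval_eq_zero
    (P := (X ^ 2 - C (AdjoinRoot.root p) : (AdjoinRoot p)[X])) (x := AdjoinRoot.mk p q₀)
    ⟨p.natDegree, by
      simpa [AdjoinRoot.mk_X] using AdjoinRoot.mk_eq_zero.2 hdvd⟩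
    (by
      have h2 : IsUnit (2 : AdjoinRoot p) := by
        simpa only [map_ofNat] using
          (isUnit_iff_ne_zero.2 (two_ne_zero (α := ℂ))).map (AdjoinRoot.of p)
      simpa [one_add_one_eq_two] using h2.mul hunit)
  obtain ⟨q, rfl⟩ := AdjoinRoot.mk_surjective r
  exact ⟨q, AdjoinRoot.mk_eq_zero.1 (by simpa [AdjoinRoot.mk_X] using hr)⟩

section SympAdj

variable {ι : Type*} [Fintype ι] [DecidableEq ι]

/-- The adjoint of `M` for the bilinear form with matrix `J`, when `J * J = -1`. -/
def sympAdj {S : Type*} [CommRing S] (J M : Matrix ι ι S) : Matrix ι ι S := -(J * Mᵀ * J)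

variable {S : Type*} [CommRing S] {J : Matrix ι ι S}

theorem sympAdj_add (M N : Matrix ι ι S) : sympAdj J (M + N) = sympAdj J M + sympAdj J N := by
  simp [sympAdj, mul_add, add_mul, add_comm]

theorem sympAdj_smul (c : S) (M : Matrix ι ι S) : sympAdj J (c • M) = c • sympAdj J M := by
  simp [sympAdj]

theorem sympAdj_mul (hJ : J * J = -1) (M N : Matrix ι ι S) :
    sympAdj J (M * N) = sympAdj J N * sympAdj J M := by
  have : J * Nᵀ * J * (J * Mᵀ * J) = J * Nᵀ * (J * J) * Mᵀ * J := by noncomm_ring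
  simp only [sympAdj, neg_mul_neg, this, hJ, transpose_mul]
  noncomm_ring

theorem sympAdj_one (hJ : J * J = -1) : sympAdj J (1 : Matrix ι ι S) = 1 := by
  simp [sympAdj, hJ]

theorem sympAdj_sympAdj (hJ : J * J = -1) (hJt : Jᵀ = -J) (M : Matrix ι ι S) :
    sympAdj J (sympAdj J M) = M := by
  have : J * (J * (M * J)) * J = J * J * M * (J * J) := by noncomm_ring
  simp [sympAdj, hJt, this, hJ]

theorem mul_sympAdj_eq_one_iff (hJ : J * J = -1) (M : Matrix ι ι S) :
    M * sympAdj J M = 1 ↔ M * J * Mᵀ = J := by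
  constructor
  · intro h
    calc M * J * Mᵀ = (M * sympAdj J M) * J := by
          have : M * (J * Mᵀ * J) * J = M * J * Mᵀ * (J * J) := by noncomm_ring
          simp [sympAdj, this, hJ]
      _ = J := by rw [h, one_mul]
  · intro h
    calc M * sympAdj J M = -(M * J * Mᵀ * J) := by simp [sympAdj, mul_assoc]
      _ = 1 := by rw [h, hJ, neg_neg]

theorem sympAdj_map {T : Type*} [CommRing T] (f : S →+* T) (J M : Matrix ι ι S) :
    (sympAdj J M).map f = sympAdj (J.map f) (M.map f) := by
  have : ∀ N : Matrix ι ι S, N.map f = f.mapMatrix N := fun _ => rfl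
  rw [sympAdj, sympAdj, ← transpose_map]
  simp only [this, map_neg, map_mul]

theorem sympAdj_aeval [Algebra ℂ S] (hJ : J * J = -1) {u : Matrix ι ι S} (hu : sympAdj J u = u)
    (q : Polynomial ℂ) : sympAdj J (Polynomial.aeval u q) = Polynomial.aeval u q := by
  induction q using Polynomial.induction_on' with
  | add p q hp hq => simp [sympAdj_add, hp, hq]
  | monomial k a =>
    rw [Polynomial.aeval_monomial, Algebra.algebraMap_eq_smul_one, smul_mul_assoc, one_mul,
      ← algebraMap_smul S a, sympAdj_smul]
    congr 1
    induction k with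
    | zero => simp [sympAdj_one hJ]
    | succ k ih => rw [pow_succ', sympAdj_mul hJ, ih, hu, ← pow_succ, pow_succ']

open Polynomial in
/-- If two elements of the group of the form `J` are conjugate by an invertible matrix, they are
conjugate inside the group, as soon as square roots can be extracted. -/
theorem exists_symp_conj [Algebra ℂ S] (hJ : J * J = -1) (hJt : Jᵀ = -J)
    (halg : ∀ u : Matrix ι ι S, IsUnit u → ∃ p : ℂ[X], p.eval 0 ≠ 0 ∧ aeval u p = 0)
    {A K D : Matrix ι ι S} (hA : A * sympAdj J A = 1) (hD : D * sympAdj J D = 1)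
    (hK : IsUnit K) (hAK : A * K = K * D) :
    ∃ g : Matrix ι ι S, g * sympAdj J g = 1 ∧ A = g * D * sympAdj J g := by
  have hA' := mul_eq_one_comm.1 hA
  obtain ⟨K', hK1, hK2⟩ := isUnit_iff_exists.1 hK
  set u := sympAdj J K * K with hu
  have hDu : D * u = u * D := by
    have h1 : sympAdj J K * sympAdj J A = sympAdj J D * sympAdj J K := by
      rw [← sympAdj_mul hJ, hAK, sympAdj_mul hJ]
    have h2 : D * sympAdj J K = sympAdj J K * A := by
      calc D * sympAdj J K = D * (sympAdj J K * sympAdj J A) * A := by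
            rw [mul_assoc, mul_assoc, hA', mul_one]
        _ = (D * sympAdj J D) * (sympAdj J K * A) := by rw [h1]; noncomm_ring
        _ = sympAdj J K * A := by rw [hD, one_mul]
    rw [hu, ← mul_assoc, h2, mul_assoc, hAK, mul_assoc]
  have huadj : sympAdj J u = u := by rw [hu, sympAdj_mul hJ, sympAdj_sympAdj hJ hJt]
  have huu : IsUnit u := by
    refine (IsUnit.of_mul_eq_one (sympAdj J K') ?_).mul hK
    rw [← sympAdj_mul hJ, hK2, sympAdj_one hJ]
  obtain ⟨p, hp0, hp⟩ := halg u huu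
  obtain ⟨q, q', hq⟩ := exists_polynomial_dvd_sq_sub_X hp0
  set r := aeval u q with hr
  have hrr : r * r = u := by
    have := congrArg (aeval u) hq
    rw [map_mul, hp, zero_mul, map_sub, aeval_X, map_pow, sub_eq_zero, sq] at this
    exact this
  have hradj : sympAdj J r = r := sympAdj_aeval hJ huadj q
  have hDr : Commute D r := by
    rw [hr, aeval_eq_sum_range]
    refine Commute.sum_right _ _ _ fun i _ => Commute.smul_right (Commute.pow_right hDu i) _
  have hru : IsUnit r := isUnit_of_mul_isUnit_left (hrr ▸ huu)
  obtain ⟨r', hr1, hr2⟩ := isUnit_iff_exists.1 hru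
  have hr'adj : sympAdj J r' = r' := by
    have : sympAdj J r' * r = 1 := by
      conv_lhs => rw [← hradj]
      rw [← sympAdj_mul hJ, hr1, sympAdj_one hJ]
    calc sympAdj J r' = sympAdj J r' * (r * r') := by rw [hr1, mul_one]
      _ = r' := by rw [← mul_assoc, this, one_mul]
  have hgg : K * r' * sympAdj J (K * r') = 1 := by
    rw [mul_eq_one_comm, sympAdj_mul hJ, hr'adj]
    calc r' * sympAdj J K * (K * r') = r' * u * r' := by rw [hu]; noncomm_ring
      _ = (r' * r) * (r * r') := by rw [← hrr]; noncomm_ring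
      _ = 1 := by rw [hr1, hr2, one_mul]
  refine ⟨K * r', hgg, ?_⟩
  have hDr' : D * r' = r' * D := by
    calc D * r' = r' * (r * D) * r' := by rw [← mul_assoc, hr2, one_mul]
      _ = r' * D * (r * r') := by rw [← hDr.eq]; noncomm_ring
      _ = r' * D := by rw [hr1, mul_one]
  have hAg : K * r' * D = A * (K * r') := by
    rw [mul_assoc, ← hDr', ← mul_assoc, ← hAK, mul_assoc]
  rw [hAg, mul_assoc, hgg, mul_one]

end SympAdj

section Cayley

variable {ι : Type*} [Fintype ι] [DecidableEq ι]

theorem sympAdj_eq_of_cayley {S : Type*} [CommRing S] {J : Matrix ι ι S} (hJ : J * J = -1)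
    {X W : Matrix ι ι S} (hX : sympAdj J X = -X) (hu : IsUnit (1 + X))
    (hW : W * (1 + X) = 1 - X) : W * sympAdj J W = 1 := by
  have hadj : sympAdj J (1 + X) = 1 - X := by
    rw [sympAdj_add, sympAdj_one hJ, hX, sub_eq_add_neg]
  have hadj' : sympAdj J (1 - X) = 1 + X := by
    rw [sub_eq_add_neg, ← neg_one_smul S X, sympAdj_add, sympAdj_one hJ, sympAdj_smul, hX]
    simp
  have hu' : IsUnit (1 - X) := by
    obtain ⟨V, hV, -⟩ := isUnit_iff_exists.1 hu
    refine IsUnit.of_mul_eq_one_right (sympAdj J V) ?_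
    rw [← hadj, ← sympAdj_mul hJ, hV, sympAdj_one hJ]
  rw [mul_eq_one_comm]
  apply hu'.mul_left_cancel
  apply hu.mul_right_cancel
  have h2 := congrArg (sympAdj J) hW
  rw [sympAdj_mul hJ, hadj, hadj'] at h2
  calc (1 - X) * (sympAdj J W * W) * (1 + X) = ((1 - X) * sympAdj J W) * (W * (1 + X)) := by
        noncomm_ring
    _ = (1 - X) * 1 * (1 + X) := by rw [h2, hW]; noncomm_ring

theorem exists_cayley {S : Type*} [CommRing S] {J : Matrix ι ι S} (hJ : J * J = -1)
    {W : Matrix ι ι S} (hW : W * sympAdj J W = 1) (h2 : IsUnit (2 : S)) (hu : IsUnit (1 + W)) :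
    ∃ X : Matrix ι ι S, sympAdj J X = -X ∧ IsUnit (1 + X) ∧ W * (1 + X) = 1 - X := by
  obtain ⟨V, hV, hV'⟩ := isUnit_iff_exists.1 hu
  have h1 : (1 - W) * V * (1 + W) = 1 - W := by rw [mul_assoc, hV', mul_one]
  have h3 : (1 + W) * ((1 - W) * V) = 1 - W := by
    calc (1 + W) * ((1 - W) * V) = (1 - W) * ((1 + W) * V) := by noncomm_ring
      _ = 1 - W := by rw [hV, mul_one]
  set X := (1 - W) * V with hX
  refine ⟨X, ?_, ?_, ?_⟩
  · have h4 := congrArg (sympAdj J) h3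
    rw [sympAdj_mul hJ, sympAdj_add, sub_eq_add_neg, ← neg_one_smul S W, sympAdj_add,
      sympAdj_one hJ, sympAdj_smul] at h4
    apply hu.mul_right_cancel
    have hW' := mul_eq_one_comm.1 hW
    calc sympAdj J X * (1 + W) = sympAdj J X * (1 + sympAdj J W) * W := by
          rw [mul_assoc, add_mul 1, hW', one_mul, add_comm]
      _ = -X * (1 + W) := by
          rw [h4, neg_mul, h1, add_mul, smul_mul_assoc, hW']
          simp [sub_eq_add_neg, add_comm]
  · have h5 : (1 + X) * (1 + W) = (2 : S) • 1 := by
      rw [add_mul, h1, two_smul]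
      noncomm_ring
    refine isUnit_of_mul_isUnit_left (y := 1 + W) ?_
    rw [h5]
    simpa [Algebra.algebraMap_eq_smul_one] using h2.map (algebraMap S (Matrix ι ι S))
  · rw [add_mul, one_mul] at h3
    rw [mul_add, mul_one, eq_sub_of_add_eq' h3]
    abel

omit [Fintype ι] [DecidableEq ι] in
theorem aeval_map {S T : Type*} [CommRing S] [Algebra ℂ S] [CommRing T] [Algebra ℂ T]
    (ψ : S →ₐ[ℂ] T) (M : Matrix ι ι S) (f : MvPolynomial (ι × ι) ℂ) :
    MvPolynomial.aeval (fun q : ι × ι => (M.map ψ) q.1 q.2) f =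
      ψ (MvPolynomial.aeval (fun q : ι × ι => M q.1 q.2) f) :=
  (MvPolynomial.comp_aeval_apply _ _ f).symm

theorem algebraMap_mul_self {S : Type*} [CommRing S] [Algebra ℂ S] {J : Matrix ι ι ℂ}
    (hJ : J * J = -1) : J.map (algebraMap ℂ S) * J.map (algebraMap ℂ S) = -1 := by
  have := congrArg (algebraMap ℂ S).mapMatrix hJ
  rwa [map_mul, map_neg, map_one] at this

theorem sympAdj_mapMatrix {S T : Type*} [CommRing S] [Algebra ℂ S] [CommRing T] [Algebra ℂ T]
    (ψ : S →ₐ[ℂ] T) (J : Matrix ι ι ℂ) (M : Matrix ι ι S) :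
    ψ.mapMatrix (sympAdj (J.map (algebraMap ℂ S)) M) =
      sympAdj (J.map (algebraMap ℂ T)) (ψ.mapMatrix M) := by
  have : J.map (algebraMap ℂ T) = (J.map (algebraMap ℂ S)).map ψ := by
    ext i j
    simp
  rw [this]
  exact sympAdj_map ψ.toRingHom _ _

theorem isUnit_of_isUnit_mapMatrix {S T : Type*} [CommRing S] [Algebra ℂ S] [CommRing T]
    [Algebra ℂ T] (ψ : S →ₐ[ℂ] T) [IsLocalHom ψ] {M : Matrix ι ι S}
    (hM : IsUnit (ψ.mapMatrix M)) : IsUnit M := by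
  rw [isUnit_iff_isUnit_det] at hM ⊢
  rw [← AlgHom.map_det] at hM
  exact hM.of_map

theorem exists_algHom_localizationAway {P T : Type*} [CommRing P] [Algebra ℂ P] [CommRing T]
    [Algebra ℂ T] (F : P →ₐ[ℂ] T) {d : P} (hd : IsUnit (F d)) :
    ∃ ψ : Localization.Away d →ₐ[ℂ] T,
      ψ.comp (IsScalarTower.toAlgHom ℂ P (Localization.Away d)) = F :=
  ⟨IsLocalization.liftAlgHom (M := Submonoid.powers d) (f := F) (S := Localization.Away d) (by
    rintro ⟨_, k, rfl⟩
    rw [map_pow]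
    exact hd.pow k), AlgHom.ext fun x => IsLocalization.lift_eq _ x⟩

/-- The symplectic group scheme over `ℂ` is reduced: a polynomial vanishing on the complex points
vanishes at every point with values in a thickening of `ℂ`. -/
theorem aeval_eq_zero_of_symp {J : Matrix ι ι ℂ} (hJ : J * J = -1) (hJt : Jᵀ = -J)
    {f : MvPolynomial (ι × ι) ℂ}
    (hf : ∀ g : Matrix ι ι ℂ, g * sympAdj J g = 1 →
      MvPolynomial.aeval (fun q : ι × ι => g q.1 q.2) f = 0)
    {S : Type} [CommRing S] [Algebra ℂ S] (φ : S →ₐ[ℂ] ℂ) [IsLocalHom φ]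
    {g : Matrix ι ι S} (hg : g * sympAdj (J.map (algebraMap ℂ S)) g = 1) :
    MvPolynomial.aeval (fun q : ι × ι => g q.1 q.2) f = 0 := by
  have hJS := algebraMap_mul_self (S := S) hJ
  have hJtS : (J.map (algebraMap ℂ S))ᵀ = -J.map (algebraMap ℂ S) := by
    rw [← transpose_map, hJt]
    ext i j
    simp
  have hJC : J.map (algebraMap ℂ ℂ) = J := by ext i j; simp
  have h2 : ∀ {T : Type} [CommRing T] [Algebra ℂ T], IsUnit (2 : T) := fun {T} _ _ => by
    simpa only [map_ofNat] using
      (isUnit_iff_ne_zero.2 (two_ne_zero (α := ℂ))).map (algebraMap ℂ T)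
  -- The translate `W` of `g` by the inverse of its reduction `h` has a Cayley transform.
  set h : Matrix ι ι ℂ := φ.mapMatrix g with hh
  have hhh : h * sympAdj J h = 1 := by
    have := congrArg φ.mapMatrix hg
    rwa [map_mul, sympAdj_mapMatrix, map_one, hJC] at this
  set hS : Matrix ι ι S := (Algebra.ofId ℂ S).mapMatrix h with hhS
  have hhhS : hS * sympAdj (J.map (algebraMap ℂ S)) hS = 1 := by
    have := congrArg (Algebra.ofId ℂ S).mapMatrix hhh
    rw [← hJC] at this
    rwa [map_mul, sympAdj_mapMatrix, map_one] at this
  have hφh : φ.mapMatrix hS = h := by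
    ext i j
    simp [hhS, Algebra.ofId_apply]
  set W := g * sympAdj (J.map (algebraMap ℂ S)) hS with hW
  have hWW : W * sympAdj (J.map (algebraMap ℂ S)) W = 1 := by
    rw [hW, sympAdj_mul hJS, sympAdj_sympAdj hJS hJtS]
    calc g * sympAdj (J.map (algebraMap ℂ S)) hS * (hS * sympAdj (J.map (algebraMap ℂ S)) g)
        = g * (sympAdj (J.map (algebraMap ℂ S)) hS * hS) * sympAdj (J.map (algebraMap ℂ S)) g := by
          noncomm_ring
      _ = 1 := by rw [mul_eq_one_comm.1 hhhS, mul_one, hg]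
  have hφW : φ.mapMatrix W = 1 := by
    rw [hW, map_mul, sympAdj_mapMatrix, hφh, hJC, hhh]
  have hWu : IsUnit (1 + W) := by
    refine isUnit_of_isUnit_mapMatrix φ ?_
    rw [map_add, map_one, hφW, one_add_one_eq_two]
    simpa only [map_ofNat] using
      (isUnit_iff_ne_zero.2 (two_ne_zero (α := ℂ))).map (algebraMap ℂ (Matrix ι ι ℂ))
  obtain ⟨X, hX, hXu, hWX⟩ := exists_cayley hJS hWW h2 hWu
  -- The generic Cayley transform, over the localization `L` of a polynomial ring `P`.
  let P := MvPolynomial (ι × ι) ℂ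
  let Y : Matrix ι ι P := of fun i j => MvPolynomial.X (i, j)
  let Xg : Matrix ι ι P := Y - sympAdj (J.map (algebraMap ℂ P)) Y
  let d : P := (1 + Xg).det
  let L := Localization.Away d
  let α : P →ₐ[ℂ] L := IsScalarTower.toAlgHom ℂ P L
  have hdu : IsUnit (1 + α.mapMatrix Xg) := by
    rw [isUnit_iff_isUnit_det, ← map_one α.mapMatrix, ← map_add, ← AlgHom.map_det]
    exact IsLocalization.Away.algebraMap_isUnit d
  let WL : Matrix ι ι L := (1 - α.mapMatrix Xg) * (1 + α.mapMatrix Xg)⁻¹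
  have hWL : WL * (1 + α.mapMatrix Xg) = 1 - α.mapMatrix Xg := by
    rw [mul_assoc, nonsing_inv_mul _ ((isUnit_iff_isUnit_det _).1 hdu), mul_one]
  let a : L := MvPolynomial.aeval
    (fun q : ι × ι => (WL * (Algebra.ofId ℂ L).mapMatrix h) q.1 q.2) f
  have hspec : ∀ {T : Type} [CommRing T] [Algebra ℂ T] (Z : Matrix ι ι T),
      IsUnit (1 + (Z - sympAdj (J.map (algebraMap ℂ T)) Z)) →
      ∃ ψ : L →ₐ[ℂ] T, ψ.comp α = MvPolynomial.aeval (fun q : ι × ι => Z q.1 q.2) ∧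
        ψ.mapMatrix WL * (1 + (Z - sympAdj (J.map (algebraMap ℂ T)) Z)) =
          1 - (Z - sympAdj (J.map (algebraMap ℂ T)) Z) ∧
        ψ a = MvPolynomial.aeval (fun q : ι × ι =>
          (ψ.mapMatrix WL * (Algebra.ofId ℂ T).mapMatrix h) q.1 q.2) f := by
    intro T _ _ Z hZ
    have hZX : (MvPolynomial.aeval fun q : ι × ι => Z q.1 q.2).mapMatrix Xg =
        Z - sympAdj (J.map (algebraMap ℂ T)) Z := by
      have : (MvPolynomial.aeval fun q : ι × ι => Z q.1 q.2).mapMatrix Y = Z := by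
        ext i j
        simp [Y]
      rw [map_sub, sympAdj_mapMatrix, this]
    have hd : IsUnit (MvPolynomial.aeval (fun q : ι × ι => Z q.1 q.2) d) := by
      rw [AlgHom.map_det, map_add, map_one, hZX]
      exact (isUnit_iff_isUnit_det _).1 hZ
    obtain ⟨ψ, hψ⟩ := exists_algHom_localizationAway _ hd
    have hψX : ψ.mapMatrix (α.mapMatrix Xg) = Z - sympAdj (J.map (algebraMap ℂ T)) Z := by
      rw [← hZX, ← hψ]
      rfl
    refine ⟨ψ, hψ, ?_, ?_⟩
    · rw [← hψX, ← map_one ψ.mapMatrix, ← map_add, ← map_mul, hWL, map_sub]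
    · have h1 : (Algebra.ofId ℂ T).mapMatrix h = ψ.mapMatrix ((Algebra.ofId ℂ L).mapMatrix h) := by
        ext i j
        exact (ψ.commutes (h i j)).symm
      rw [h1, ← map_mul]
      exact (aeval_map ψ _ f).symm
  have ha : a = 0 := by
    obtain ⟨k, q, hq⟩ := IsLocalization.Away.surj d a
    have hqd : q * d = 0 := by
      refine MvPolynomial.funext fun z => ?_
      rw [map_mul, map_zero]
      by_cases hz : MvPolynomial.eval z d = 0
      · rw [hz, mul_zero]
      let Z : Matrix ι ι ℂ := of fun i j => z (i, j)
      have hz' : MvPolynomial.aeval (R := ℂ) (fun q : ι × ι => Z q.1 q.2) =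
          MvPolynomial.aeval z := rfl
      have hZ : IsUnit (1 + (Z - sympAdj (J.map (algebraMap ℂ ℂ)) Z)) := by
        rw [isUnit_iff_isUnit_det, isUnit_iff_ne_zero]
        convert hz
        rw [← MvPolynomial.coe_aeval_eq_eval, RingHom.coe_coe, AlgHom.map_det, map_add, map_one,
          map_sub, sympAdj_mapMatrix]
        have : (MvPolynomial.aeval z).mapMatrix Y = Z := by
          ext i j
          simp [Y, Z]
        rw [this]
      obtain ⟨ψ, hψ, hψ1, hψ2⟩ := hspec Z hZ
      have hadj : sympAdj J (Z - sympAdj J Z) = -(Z - sympAdj J Z) := by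
        rw [sub_eq_add_neg, ← neg_one_smul ℂ (sympAdj J Z), sympAdj_add, sympAdj_smul,
          sympAdj_sympAdj hJ hJt]
        simp
      rw [hJC] at hψ1 hZ
      have hWz := sympAdj_eq_of_cayley hJ hadj hZ hψ1
      have hψa : ψ a = 0 := by
        rw [hψ2]
        apply hf
        have h1 : (Algebra.ofId ℂ ℂ).mapMatrix h = h := by
          ext i j
          simp
        rw [h1, sympAdj_mul hJ]
        calc ψ.mapMatrix WL * h * (sympAdj J h * sympAdj J (ψ.mapMatrix WL))
            = ψ.mapMatrix WL * (h * sympAdj J h) * sympAdj J (ψ.mapMatrix WL) := by noncomm_ring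
          _ = 1 := by rw [hhh, mul_one, hWz]
      have hzq : MvPolynomial.eval z q = 0 := by
        rw [← MvPolynomial.coe_aeval_eq_eval, RingHom.coe_coe, ← hz', ← hψ]
        change ψ (algebraMap P L q) = 0
        rw [← hq, map_mul, hψa, zero_mul]
      rw [hzq, zero_mul]
    have hq0 : algebraMap P L q = 0 := by
      have := congrArg (algebraMap P L) hqd
      rwa [map_mul, map_zero, (IsLocalization.Away.algebraMap_isUnit d).mul_left_eq_zero] at this
    rw [hq0] at hq
    exact (((IsLocalization.Away.algebraMap_isUnit d).pow k).mul_left_eq_zero).1 hq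
  -- Specialise to `S`.
  let Z : Matrix ι ι S := algebraMap ℂ S (1 / 2) • X
  have hZX : Z - sympAdj (J.map (algebraMap ℂ S)) Z = X := by
    rw [sympAdj_smul, hX, smul_neg, sub_neg_eq_add, ← add_smul, ← map_add]
    norm_num
  obtain ⟨ψ, -, hψ1, hψ2⟩ := hspec Z (by rwa [hZX])
  rw [hZX] at hψ1
  have hψW : ψ.mapMatrix WL = W := hXu.mul_right_cancel (hψ1.trans hWX.symm)
  have hWg : W * hS = g := by
    rw [hW, mul_assoc, mul_eq_one_comm.1 hhhS, mul_one]
  rw [ha, map_zero, hψW] at hψ2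
  rw [← hWg]
  exact hψ2.symm

end Cayley

section Spectral

variable {ι : Type*} [Fintype ι] [DecidableEq ι] {S : Type*} [CommRing S] [Algebra ℂ S]

open Polynomial

theorem aeval_eq_zero_of_eval_eq_zero {R : Type*} [Ring R] [Algebra ℂ R] {a : R} {Λ : Finset ℂ}
    (ha : aeval a (∏ z ∈ Λ, (X - C z)) = 0) {q : ℂ[X]} (hq : ∀ z ∈ Λ, q.eval z = 0) :
    aeval a q = 0 := by
  have : ∏ z ∈ Λ, (X - C z) ∣ q := Finset.prod_dvd_of_coprime
    (fun x _ y _ hxy => pairwise_coprime_X_sub_C Function.injective_id hxy)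
    fun z hz => dvd_iff_isRoot.2 (hq z hz)
  obtain ⟨r, rfl⟩ := this
  rw [map_mul, ha, zero_mul]

theorem trace_aeval {A : Matrix ι ι S} {d : ι → ℂ}
    (htr : ∀ k, 1 ≤ k → k ≤ Fintype.card ι →
      trace (A ^ k) = algebraMap ℂ S (∑ i, d i ^ k)) {q : ℂ[X]}
    (hq : q.natDegree ≤ Fintype.card ι) :
    trace (aeval A q) = algebraMap ℂ S (∑ i, q.eval (d i)) := by
  have htr' : ∀ k ≤ Fintype.card ι, trace (A ^ k) = algebraMap ℂ S (∑ i, d i ^ k) := by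
    intro k hk
    rcases Nat.eq_zero_or_pos k with rfl | h
    · simp
    · exact htr k h hk
  simp_rw [aeval_eq_sum_range, eval_eq_sum_range, trace_sum, trace_smul]
  rw [Finset.sum_comm, map_sum]
  refine Finset.sum_congr rfl fun k hk => ?_
  rw [htr' k ((Finset.mem_range_succ_iff.1 hk).trans hq), ← Finset.mul_sum, map_mul,
    Algebra.smul_def]

omit [Algebra ℂ S] in
theorem free_range_and_trace_of_isIdempotentElem {M : Type*} [AddCommGroup M] [Module S M]
    [Module.Finite S M] [Module.Free S M] [IsLocalRing S] {f : M →ₗ[S] M}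
    (hf : IsIdempotentElem f) :
    Module.Free S (LinearMap.range f) ∧
      LinearMap.trace S M f = Module.finrank S (LinearMap.range f) := by
  have hff : ∀ x, f (f x) = f x := fun x => LinearMap.congr_fun hf x
  have hproj : LinearMap.IsProj (LinearMap.range f) f :=
    ⟨fun x => ⟨x, rfl⟩, by rintro _ ⟨x, rfl⟩; exact hff x⟩
  have hfree : Module.Free S (LinearMap.range f) := by
    have : Module.Projective S (LinearMap.range f) :=
      Module.Projective.of_split (LinearMap.range f).subtype f.rangeRestrict
        (LinearMap.ext fun ⟨x, hx⟩ => Subtype.ext (hproj.map_id x hx))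
    exact Module.free_of_flat_of_isLocalRing
  let g : M →ₗ[S] LinearMap.ker f :=
    (LinearMap.id - f).codRestrict _ fun x => by simp [hff]
  have hg : g ∘ₗ (LinearMap.ker f).subtype = LinearMap.id :=
    LinearMap.ext fun ⟨x, hx⟩ => Subtype.ext (by simpa [g] using hx)
  have hkfin : Module.Finite S (LinearMap.ker f) :=
    Module.Finite.of_surjective g fun x => ⟨x, LinearMap.congr_fun hg x⟩
  have hkfree : Module.Free S (LinearMap.ker f) := by
    have : Module.Projective S (LinearMap.ker f) := Module.Projective.of_split _ g hg
    exact Module.free_of_flat_of_isLocalRing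
  exact ⟨hfree, hproj.trace⟩

/-- Over a local `ℂ`-algebra, a matrix annihilated by a split separable polynomial is conjugate to
the diagonal matrix whose power sums are the traces of its powers. -/
theorem exists_conj_diagonal [IsLocalRing S] [Nonempty ι] {A : Matrix ι ι S} {d : ι → ℂ}
    {Λ : Finset ℂ} (hd : ∀ i, d i ∈ Λ) (hcard : Λ.card ≤ Fintype.card ι)
    (hA : aeval A (∏ z ∈ Λ, (X - C z)) = 0)
    (htr : ∀ k, 1 ≤ k → k ≤ Fintype.card ι → trace (A ^ k) = algebraMap ℂ S (∑ i, d i ^ k)) :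
    ∃ K : Matrix ι ι S, IsUnit K ∧ A * K = K * diagonal fun i => algebraMap ℂ S (d i) := by
  classical
  have hcz : CharZero S := charZero_of_injective_algebraMap (algebraMap ℂ S).injective
  have hne : Λ.Nonempty := ⟨_, hd (Classical.arbitrary ι)⟩
  have hinj : Set.InjOn (id : ℂ → ℂ) Λ := Function.injective_id.injOn
  have hev : ∀ z ∈ Λ, ∀ w ∈ Λ, (Lagrange.basis Λ id z).eval w = if w = z then 1 else 0 := by
    intro z hz w hw
    split_ifs with h
    · subst h; exact Lagrange.eval_basis_self hinj hw
    · exact Lagrange.eval_basis_of_ne (v := id) (Ne.symm h) hw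
  let P : ℂ → Matrix ι ι S := fun z => aeval A (Lagrange.basis Λ id z)
  have hsum : ∑ z ∈ Λ, P z = 1 := by
    rw [← map_sum, Lagrange.sum_basis hinj hne, map_one]
  have hidem : ∀ z ∈ Λ, P z * P z = P z := by
    intro z hz
    rw [← sub_eq_zero, ← map_mul, ← map_sub]
    refine aeval_eq_zero_of_eval_eq_zero hA fun w hw => ?_
    rw [eval_sub, eval_mul, hev z hz w hw]
    split_ifs <;> simp
  have heig : ∀ z ∈ Λ, A * P z = algebraMap ℂ S z • P z := by
    intro z hz
    have : aeval A ((X - C z) * Lagrange.basis Λ id z) = 0 := by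
      refine aeval_eq_zero_of_eval_eq_zero hA fun w hw => ?_
      by_cases h : w = z <;> simp [hev z hz w hw, h]
    rw [map_mul, map_sub, aeval_X, aeval_C, sub_mul, sub_eq_zero] at this
    rw [this, Algebra.algebraMap_eq_smul_one, smul_mul_assoc, one_mul, algebraMap_smul]
  have hlin : ∀ z ∈ Λ, IsIdempotentElem (toLin' (P z)) := fun z hz => by
    rw [IsIdempotentElem, Module.End.mul_eq_comp, ← toLin'_mul, hidem z hz]
  have hrank : ∀ z ∈ Λ, Module.finrank S (LinearMap.range (toLin' (P z))) =
      Fintype.card {i // d i = z} := by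
    intro z hz
    have h1 := (free_range_and_trace_of_isIdempotentElem (hlin z hz)).2
    rw [trace_toLin'_eq, trace_aeval htr (by
      rw [Lagrange.natDegree_basis hinj hz]; exact (Nat.sub_le _ _).trans hcard)] at h1
    simp only [hev z hz _ (hd _)] at h1
    rw [Finset.sum_boole, map_natCast, Nat.cast_inj] at h1
    rw [← h1, Fintype.card_subtype]
  have hbasis : ∀ z ∈ Λ,
      Nonempty (Module.Basis {i // d i = z} S (LinearMap.range (toLin' (P z)))) := by
    intro z hz
    have := (free_range_and_trace_of_isIdempotentElem (hlin z hz)).1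
    exact ⟨(Module.finBasis S _).reindex ((finCongr (hrank z hz)).trans (Fintype.equivFin _).symm)⟩
  have b := fun z hz => (hbasis z hz).some
  let v : ι → ι → S := fun i => b (d i) (hd i) ⟨i, rfl⟩
  have hvb : ∀ z hz (i : {i // d i = z}), v i = b z hz i := by
    rintro z hz ⟨i, rfl⟩; rfl
  have hPv : ∀ i, A *ᵥ v i = algebraMap ℂ S (d i) • v i := by
    intro i
    obtain ⟨x, hx⟩ := (b (d i) (hd i) ⟨i, rfl⟩).2
    change A *ᵥ (b (d i) (hd i) ⟨i, rfl⟩ : ι → S) = _ • (b (d i) (hd i) ⟨i, rfl⟩ : ι → S)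
    rw [← hx, toLin'_apply, mulVec_mulVec, heig _ (hd i), smul_mulVec]
  have hKv : ∀ c : ι → S, (of fun i j => v j i) *ᵥ c = ∑ j, c j • v j := by
    intro c
    ext i
    simp [mulVec, dotProduct, mul_comm]
  refine ⟨of fun i j => v j i, ?_, ?_⟩
  · rw [← mulVec_surjective_iff_isUnit]
    intro x
    have hx : x = ∑ z ∈ Λ, P z *ᵥ x := by
      rw [← Matrix.sum_mulVec, hsum, one_mulVec]
    suffices h : x ∈ LinearMap.range (mulVecLin (of fun i j => v j i)) by
      simpa using h
    rw [hx]
    refine Submodule.sum_mem _ fun z hz => ?_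
    have h2 := (b z hz).sum_repr ⟨P z *ᵥ x, x, by simp⟩
    replace h2 := congrArg Subtype.val h2
    simp only [AddSubmonoidClass.coe_finsetSum, Submodule.coe_smul] at h2
    rw [← h2]
    refine Submodule.sum_mem _ fun i _ => Submodule.smul_mem _ _ ⟨Pi.single i.1 1, ?_⟩
    rw [mulVecLin_apply, hKv, ← hvb z hz i]
    simp [Pi.single_apply]
  · ext i j
    rw [mul_diagonal]
    simpa [mulVec, dotProduct, mul_apply, mul_comm] using congrFun (hPv j) i

end Spectral

section Thickening

theorem mem_of_forall_thickening {σ : Type} [Finite σ] {I : Ideal (MvPolynomial σ ℂ)}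
    {f : MvPolynomial σ ℂ}
    (h : ∀ (S : Type) [CommRing S] [Algebra ℂ S] (φ : S →ₐ[ℂ] ℂ),
      (∀ x, φ x = 0 → IsNilpotent x) → ∀ ψ : MvPolynomial σ ℂ →ₐ[ℂ] S,
        (∀ x ∈ I, ψ x = 0) → ψ f = 0) : f ∈ I := by
  by_contra hf
  let Q := MvPolynomial σ ℂ ⧸ I
  let c : Ideal (MvPolynomial σ ℂ) := LinearMap.ker (LinearMap.toSpanSingleton (MvPolynomial σ ℂ) Q
    (Ideal.Quotient.mk I f))
  have hc : ∀ x, x ∈ c ↔ x * f ∈ I := fun x => by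
    rw [← Ideal.Quotient.eq_zero_iff_mem (I := I), map_mul]
    rfl
  have hctop : c ≠ ⊤ := fun H => hf (by
    have := (hc 1).1 (H ▸ Submodule.mem_top)
    rwa [one_mul] at this)
  obtain ⟨M, hM, hcM⟩ := Ideal.exists_le_maximal c hctop
  have hIM : I ≤ M := fun x hx => hcM ((hc x).2 (I.mul_mem_right f hx))
  obtain ⟨z, hz⟩ := MvPolynomial.isMaximal_iff_eq_vanishingIdeal_singleton.1 hM
  have hzM : ∀ x, x ∈ M ↔ MvPolynomial.aeval z x = 0 := fun x => by
    rw [hz, MvPolynomial.mem_vanishingIdeal_singleton_iff]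
  have key : ∀ k, f ∈ I ⊔ M ^ (k + 1) := by
    intro k
    have hle : I ⊔ M ^ (k + 1) ≤ M := sup_le hIM (Ideal.pow_le_self k.succ_ne_zero)
    have := h (MvPolynomial σ ℂ ⧸ (I ⊔ M ^ (k + 1)))
      (Ideal.Quotient.liftₐ _ (MvPolynomial.aeval z) fun x hx => (hzM x).1 (hle hx))
      (by
        intro x hx
        obtain ⟨y, rfl⟩ := Ideal.Quotient.mk_surjective x
        refine ⟨k + 1, ?_⟩
        rw [← map_pow, Ideal.Quotient.eq_zero_iff_mem]
        exact Ideal.mem_sup_right (Ideal.pow_mem_pow ((hzM y).2 hx) _))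
      (Ideal.Quotient.mkₐ ℂ _)
      (fun x hx => Ideal.Quotient.eq_zero_iff_mem.2 (Ideal.mem_sup_left hx))
    exact Ideal.Quotient.eq_zero_iff_mem.1 this
  have hmem : (Ideal.Quotient.mk I f : Q) ∈
      (⨅ i : ℕ, M ^ i • ⊤ : Submodule (MvPolynomial σ ℂ) Q) := by
    rw [Submodule.mem_iInf]
    intro i
    have hi : f ∈ I ⊔ M ^ i := sup_le_sup_left (Ideal.pow_le_pow_right i.le_succ) I (key i)
    obtain ⟨a, ha, b, hb, rfl⟩ := Submodule.mem_sup.1 hi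
    rw [map_add, Ideal.Quotient.eq_zero_iff_mem.2 ha, zero_add]
    have : (Ideal.Quotient.mk I b : Q) = b • (1 : Q) := by
      change Ideal.Quotient.mk I b = Ideal.Quotient.mk I (b * 1)
      rw [mul_one]
    rw [this]
    exact Submodule.smul_mem_smul hb Submodule.mem_top
  obtain ⟨⟨r, hr⟩, hrf⟩ := (Ideal.mem_iInf_smul_pow_eq_bot_iff M _).1 hmem
  have h1r : 1 - r ∈ c := by
    rw [hc, sub_mul, one_mul, ← Ideal.Quotient.eq_zero_iff_mem, map_sub, map_mul, sub_eq_zero]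
    exact hrf.symm
  exact hM.ne_top ((Ideal.eq_top_iff_one M).2 (by simpa using M.add_mem (hcM h1r) hr))

variable {ι : Type*} [Fintype ι] [DecidableEq ι]

open Polynomial in
theorem exists_aeval_eq_zero {S : Type*} [CommRing S] [Algebra ℂ S] {φ : S →ₐ[ℂ] ℂ}
    (hφ : ∀ x, φ x = 0 → IsNilpotent x) {u : Matrix ι ι S} (hu : IsUnit u) :
    ∃ p : ℂ[X], p.eval 0 ≠ 0 ∧ aeval u p = 0 := by
  set p := (φ.mapMatrix u).charpoly with hp
  have hp0 : p.eval 0 ≠ 0 := by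
    have h1 : IsUnit (φ.mapMatrix u).det := (isUnit_iff_isUnit_det _).1 (hu.map φ.mapMatrix)
    rw [det_eq_sign_charpoly_coeff, ← hp, coeff_zero_eq_eval_zero] at h1
    exact right_ne_zero_of_mul h1.ne_zero
  have hnil : IsNilpotent (p.map (algebraMap ℂ S) - u.charpoly) := by
    rw [Polynomial.isNilpotent_iff]
    intro i
    refine hφ _ ?_
    have : p = u.charpoly.map φ.toRingHom := charpoly_map u φ.toRingHom
    rw [coeff_sub, map_sub, coeff_map, φ.commutes, this, coeff_map]
    exact sub_self _
  obtain ⟨k, hk⟩ := hnil.map (aeval u)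
  rw [map_sub, aeval_self_charpoly, sub_zero, aeval_map_algebraMap] at hk
  exact ⟨p ^ k, by rw [eval_pow]; exact pow_ne_zero k hp0, by rw [map_pow, hk]⟩

open Polynomial in
theorem aeval_eq_zero_of_relations [Nonempty ι] {J : Matrix ι ι ℂ} (hJ : J * J = -1) (hJt : Jᵀ = -J)
    {d : ι → ℂ} (hD : diagonal d * sympAdj J (diagonal d) = 1)
    {f : MvPolynomial (ι × ι) ℂ}
    (hf : ∀ g : Matrix ι ι ℂ, g * sympAdj J g = 1 →
      MvPolynomial.aeval (fun q : ι × ι => (g * diagonal d * sympAdj J g) q.1 q.2) f = 0)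
    {Λ : Finset ℂ} (hd : ∀ i, d i ∈ Λ) (hcard : Λ.card ≤ Fintype.card ι)
    {S : Type} [CommRing S] [Algebra ℂ S] (φ : S →ₐ[ℂ] ℂ) (hφ : ∀ x, φ x = 0 → IsNilpotent x)
    {A : Matrix ι ι S} (hA : A * sympAdj (J.map (algebraMap ℂ S)) A = 1)
    (hpol : aeval A (∏ z ∈ Λ, (X - C z)) = 0)
    (htr : ∀ k, 1 ≤ k → k ≤ Fintype.card ι → trace (A ^ k) = algebraMap ℂ S (∑ i, d i ^ k)) :
    MvPolynomial.aeval (fun q : ι × ι => A q.1 q.2) f = 0 := by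
  have hloc : IsLocalHom φ := ⟨fun x hx => by
    have h1 : IsNilpotent (x - algebraMap ℂ S (φ x)) := hφ _ (by simp)
    have h2 : IsUnit (algebraMap ℂ S (φ x)) := hx.map _
    simpa using h1.isUnit_add_right_of_commute h2 (Commute.all _ _)⟩
  have hlr : IsLocalRing S :=
    have : IsLocalHom φ.toRingHom := ⟨fun x hx => hloc.map_nonunit x hx⟩
    φ.toRingHom.domain_isLocalRing
  have hJS := algebraMap_mul_self (S := S) hJ
  have hJtS : (J.map (algebraMap ℂ S))ᵀ = -J.map (algebraMap ℂ S) := by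
    rw [← transpose_map, hJt]
    ext i j
    simp
  set D : Matrix ι ι S := diagonal fun i => algebraMap ℂ S (d i) with hDdef
  have hDm : ∀ (T : Type) [CommRing T] [Algebra ℂ T],
      (Algebra.ofId ℂ T).mapMatrix (diagonal d) = diagonal fun i => algebraMap ℂ T (d i) := by
    intro T _ _
    rw [AlgHom.mapMatrix_apply, diagonal_map (map_zero _)]
    rfl
  have hJC : J.map (algebraMap ℂ ℂ) = J := by ext i j; simp
  have hDS : D * sympAdj (J.map (algebraMap ℂ S)) D = 1 := by
    have := congrArg (Algebra.ofId ℂ S).mapMatrix hD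
    rw [← hJC] at this
    rwa [map_mul, sympAdj_mapMatrix, map_one, hDm S] at this
  obtain ⟨K, hK, hAK⟩ := exists_conj_diagonal hd hcard hpol htr
  obtain ⟨g, hg, hAg⟩ := exists_symp_conj hJS hJtS (fun u hu => exists_aeval_eq_zero hφ hu)
    hA hDS hK hAK
  let P := MvPolynomial (ι × ι) ℂ
  let Y : Matrix ι ι P := of fun i j => MvPolynomial.X (i, j)
  let f' : P := MvPolynomial.aeval (fun q : ι × ι =>
    (Y * (Algebra.ofId ℂ P).mapMatrix (diagonal d) * sympAdj (J.map (algebraMap ℂ P)) Y) q.1 q.2) f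
  have hf' : ∀ {T : Type} [CommRing T] [Algebra ℂ T] (Z : Matrix ι ι T),
      MvPolynomial.aeval (fun q : ι × ι => Z q.1 q.2) f' = MvPolynomial.aeval (fun q : ι × ι =>
        (Z * (diagonal fun i => algebraMap ℂ T (d i)) * sympAdj (J.map (algebraMap ℂ T)) Z) q.1 q.2)
        f := by
    intro T _ _ Z
    set ψ : P →ₐ[ℂ] T := MvPolynomial.aeval fun q : ι × ι => Z q.1 q.2 with hψ
    have hY : ψ.mapMatrix Y = Z := by
      ext i j
      exact MvPolynomial.aeval_X _ _
    have hDψ : ψ.mapMatrix ((Algebra.ofId ℂ P).mapMatrix (diagonal d)) =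
        diagonal fun i => algebraMap ℂ T (d i) := by
      rw [← hDm T]
      ext i j
      exact ψ.commutes _
    rw [← aeval_map ψ, ← AlgHom.mapMatrix_apply, map_mul, map_mul, hDψ, sympAdj_mapMatrix, hY]
  rw [hAg, ← hf']
  refine aeval_eq_zero_of_symp hJ hJt (fun h hh => ?_) φ hg
  rw [hf', hJC]
  exact hf h hh

end Thickening

/-- The skew-symmetric matrix defining the symplectic group. -/
def antidiag (n : ℕ) : Matrix (Fin (2 * n)) (Fin (2 * n)) ℂ :=
  of fun i j => if (i : ℕ) + (j : ℕ) = 2 * n - 1 then (if (i : ℕ) < n then 1 else -1) else 0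

theorem antidiag_apply {n : ℕ} (i j : Fin (2 * n)) :
    antidiag n i j = if j = i.rev then (if (i : ℕ) < n then 1 else -1) else 0 := by
  have : (i : ℕ) + (j : ℕ) = 2 * n - 1 ↔ j = i.rev := by
    rw [Fin.ext_iff, Fin.val_rev]
    omega
  simp only [antidiag, of_apply, this]

theorem antidiag_mul_self (n : ℕ) : antidiag n * antidiag n = -1 := by
  ext i k
  simp only [mul_apply, antidiag_apply, ite_mul, zero_mul, Finset.sum_ite_eq',
    Finset.mem_univ, if_true, Fin.rev_rev, Matrix.neg_apply, one_apply, Fin.val_rev]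
  by_cases h : k = i
  · subst h
    have : 2 * n - ((k : ℕ) + 1) < n ↔ ¬ (k : ℕ) < n := by omega
    by_cases hk : (k : ℕ) < n <;> simp [this, hk]
  · simp [h, Ne.symm h]

theorem transpose_antidiag (n : ℕ) : (antidiag n)ᵀ = -antidiag n := by
  ext i j
  simp only [transpose_apply, Matrix.neg_apply, antidiag_apply]
  by_cases h : j = i.rev
  · subst h
    have : 2 * n - ((i : ℕ) + 1) < n ↔ ¬ (i : ℕ) < n := by omega
    by_cases hk : (i : ℕ) < n <;> simp [this, hk, Fin.val_rev]
  · have : i ≠ j.rev := fun h' => h (by rw [h', Fin.rev_rev])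
    simp [h, this]

theorem diagonal_mul_sympAdj {n : ℕ} {d : Fin (2 * n) → ℂ} (hd : ∀ i, d i * d i.rev = 1) :
    diagonal d * sympAdj (antidiag n) (diagonal d) = 1 := by
  rw [mul_sympAdj_eq_one_iff (antidiag_mul_self n)]
  ext i j
  rw [diagonal_transpose, mul_diagonal, diagonal_mul, antidiag_apply]
  split_ifs with h
  · rw [h, mul_right_comm, hd, one_mul]
  · rw [h, mul_right_comm, hd, one_mul]
  · simp

section Lists

variable {ℓ : ℕ} (m p : ℕ) (nn : Fin ℓ → ℕ) (μ : Fin ℓ → ℂ)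

/-- The eigenvalues of the base point of the conjugacy class, with multiplicities. -/
noncomputable def eigList : List ℂ :=
  ((List.ofFn fun j : Fin ℓ => List.replicate (nn j) (μ j)).flatten)
    ++ List.replicate m (-1) ++ List.replicate (2 * p) 1 ++ List.replicate m (-1)
    ++ (((List.ofFn fun j : Fin ℓ => List.replicate (nn j) (μ j)⁻¹).flatten).reverse)

/-- The distinct eigenvalues of the base point of the conjugacy class. -/
noncomputable def rootList {ℓ : ℕ} (μ : Fin ℓ → ℂ) : List ℂ :=
  List.ofFn μ ++ [-1, 1] ++ (List.ofFn fun j => (μ j)⁻¹).reverse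

theorem length_eigList : (eigList m p nn μ).length = 2 * ((∑ j, nn j) + m + p) := by
  simp only [eigList, List.length_append, List.length_flatten, List.map_ofFn, List.length_reverse,
    List.length_replicate, List.sum_ofFn, Function.comp_apply]
  ring

theorem reverse_eigList : (eigList m p nn μ).reverse = (eigList m p nn μ).map (·⁻¹) := by
  simp [eigList, List.map_flatten, List.map_ofFn, Function.comp_def, inv_neg]

theorem mem_rootList_of_mem_eigList {z : ℂ} (hz : z ∈ eigList m p nn μ) : z ∈ rootList μ := by
  simp only [eigList, rootList, List.mem_append, List.mem_flatten, List.mem_ofFn, List.mem_reverse,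
    List.mem_replicate, List.mem_cons, List.not_mem_nil, or_false] at hz ⊢
  aesop

theorem sum_pow_eigList (k : ℕ) : ((eigList m p nn μ).map (· ^ k)).sum =
    (∑ j, (nn j : ℂ) * (μ j ^ k + (μ j)⁻¹ ^ k)) + 2 * (m : ℂ) * (-1) ^ k + 2 * (p : ℂ) := by
  simp only [eigList, List.map_append, List.sum_append, List.map_reverse, List.sum_reverse,
    List.map_flatten, List.sum_flatten, List.map_ofFn, Function.comp_def, List.map_replicate,
    List.sum_replicate, List.sum_ofFn, mul_add, Finset.sum_add_distrib, nsmul_eq_mul, one_pow]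
  push_cast
  ring

variable {m p nn μ}

theorem ne_zero_of_mem_rootList (hμ0 : ∀ j, μ j ≠ 0) {z : ℂ} (hz : z ∈ rootList μ) : z ≠ 0 := by
  simp only [rootList, List.mem_append, List.mem_ofFn, List.mem_reverse, List.mem_cons,
    List.not_mem_nil, or_false] at hz
  aesop

theorem nodup_rootList (hμ1 : ∀ j, μ j ^ 2 ≠ 1) (hμ : ∀ i j, i ≠ j → μ i ≠ μ j ∧ μ i ≠ (μ j)⁻¹)
    (hμ0 : ∀ j, μ j ≠ 0) : (rootList μ).Nodup := by
  have hinj : Function.Injective μ := fun i j h => by_contra fun hij => (hμ i j hij).1 h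
  have hne1 : ∀ j, μ j ≠ 1 := fun j h => hμ1 j (by rw [h, one_pow])
  have hne2 : ∀ j, μ j ≠ -1 := fun j h => hμ1 j (by rw [h]; norm_num)
  have hne : ∀ i j, μ i ≠ (μ j)⁻¹ := fun i j h => by
    rcases eq_or_ne i j with rfl | hij
    · exact hμ1 i (by rw [sq]; nth_rewrite 2 [h]; exact mul_inv_cancel₀ (hμ0 i))
    · exact (hμ i j hij).2 h
  have h1 : (1 : ℂ) ≠ -1 := by norm_num
  simp only [rootList, List.nodup_append, List.nodup_ofFn, List.nodup_reverse, List.mem_append,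
    List.mem_ofFn, List.mem_reverse, List.mem_cons, List.nodup_cons, List.not_mem_nil, or_false]
  refine ⟨⟨hinj, ⟨h1.symm, not_false, List.nodup_nil⟩, ?_⟩, fun i j h => hinj (inv_injective h), ?_⟩
  · rintro _ ⟨i, rfl⟩ _ (rfl | rfl)
    · exact hne2 i
    · exact hne1 i
  · rintro _ (⟨i, rfl⟩ | rfl | rfl) _ ⟨j, rfl⟩
    · exact hne i j
    · exact fun h => hne2 j (by rw [← inv_inv (μ j), ← h, inv_neg, inv_one])
    · exact fun h => hne1 j (by rw [← inv_inv (μ j), ← h, inv_one])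

theorem card_rootList_le (hm : 1 ≤ m) (hp : 1 ≤ p) (hnn : ∀ j, 0 < nn j) :
    (rootList μ).toFinset.card ≤ 2 * ((∑ j, nn j) + m + p) := by
  have h1 : ℓ ≤ ∑ j, nn j := by
    simpa using Finset.sum_le_sum fun j (_ : j ∈ Finset.univ) => Nat.succ_le_of_lt (hnn j)
  refine (List.toFinset_card_le _).trans ?_
  simp only [rootList, List.length_append, List.length_ofFn, List.length_reverse, List.length_cons,
    List.length_nil]
  omega

theorem getD_mul_getD_rev (hμ0 : ∀ j, μ j ≠ 0) {N : ℕ} (hN : (eigList m p nn μ).length = N)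
    (i : Fin N) : (eigList m p nn μ).getD i 0 * (eigList m p nn μ).getD i.rev 0 = 1 := by
  subst hN
  have h0 := ne_zero_of_mem_rootList hμ0
    (mem_rootList_of_mem_eigList m p nn μ (List.getElem_mem i.2))
  have h1 : (eigList m p nn μ)[i.rev] = (eigList m p nn μ)[i]⁻¹ := by
    have h2 : (eigList m p nn μ).reverse[(i : ℕ)]'(by simp) = (eigList m p nn μ)[i]⁻¹ := by
      simp [reverse_eigList]
    rw [← h2, List.getElem_reverse]
    simp [Fin.val_rev, Nat.sub_sub, add_comm]
  rw [List.getD_eq_getElem _ _ i.2, List.getD_eq_getElem _ _ i.rev.2]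
  erw [h1]
  exact mul_inv_cancel₀ h0

theorem sum_getD {N : ℕ} (L : List ℂ) (hN : L.length = N) (k : ℕ) :
    ∑ i : Fin N, L.getD i 0 ^ k = (L.map (· ^ k)).sum := by
  subst hN
  rw [← Fin.sum_univ_fun_getElem]
  exact Finset.sum_congr rfl fun i _ => by rw [List.getD_eq_getElem _ _ i.2]

open Polynomial in
theorem aeval_prod_rootList {R : Type*} [CommRing R] [Algebra ℂ R] {ι : Type*} [Fintype ι]
    [DecidableEq ι] (hL : (rootList μ).Nodup) (A : Matrix ι ι R) :
    aeval A (∏ z ∈ (rootList μ).toFinset, (X - C z)) =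
      ((List.ofFn fun j : Fin ℓ => A - (algebraMap ℂ R (μ j)) • (1 : Matrix ι ι R))
        ++ [A + 1, A - 1]
        ++ (List.ofFn fun j : Fin ℓ => A - (algebraMap ℂ R (μ j)⁻¹) •
          (1 : Matrix ι ι R)).reverse).prod := by
  have h : ∀ z, aeval A (X - C z) = A - (algebraMap ℂ R z) • (1 : Matrix ι ι R) := fun z => by
    rw [map_sub, aeval_X, aeval_C, Matrix.algebraMap_eq_diagonal, smul_one_eq_diagonal]
    rfl
  have h1 : A - (algebraMap ℂ R (-1)) • (1 : Matrix ι ι R) = A + 1 := by simp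
  have h2 : A - (algebraMap ℂ R 1) • (1 : Matrix ι ι R) = A - 1 := by simp
  rw [List.prod_toFinset _ hL, map_list_prod, List.map_map, rootList]
  simp only [List.map_append, List.map_ofFn, List.map_reverse, List.map_cons, List.map_nil,
    Function.comp_def, h, h1, h2]

end Lists

section Assembly

variable {ι : Type} [Fintype ι] [DecidableEq ι]

open Polynomial in
theorem span_relations_eq_vanishingIdeal [Nonempty ι] {J : Matrix ι ι ℂ} (hJ : J * J = -1)
    (hJt : Jᵀ = -J) {d : ι → ℂ} (hD : diagonal d * sympAdj J (diagonal d) = 1) {Λ : Finset ℂ}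
    (hd : ∀ i, d i ∈ Λ) {N : ℕ} (hN : Fintype.card ι = N) (hcard : Λ.card ≤ N)
    (A : Matrix ι ι (MvPolynomial (ι × ι) ℂ)) (hA : A = of fun i j => MvPolynomial.X (i, j))
    (Jp : Matrix ι ι (MvPolynomial (ι × ι) ℂ)) (hJp : Jp = J.map MvPolynomial.C) :
    Ideal.span
        ((Set.range fun q : ι × ι =>
            (A * Jp * Aᵀ - Jp) q.1 q.2) ∪
          (Set.range fun q : ι × ι => (aeval A (∏ z ∈ Λ, (X - C z))) q.1 q.2) ∪
          (Set.range fun r : Fin N =>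
            trace (A ^ ((r : ℕ) + 1)) - MvPolynomial.C (∑ i, d i ^ ((r : ℕ) + 1)))) =
      MvPolynomial.vanishingIdeal ℂ ((fun (B : Matrix ι ι ℂ) (q : ι × ι) => B q.1 q.2) ''
        {B | ∃ g : (Matrix ι ι ℂ)ˣ, (g : Matrix ι ι ℂ) * J * (g : Matrix ι ι ℂ)ᵀ = J ∧
          B = (g : Matrix ι ι ℂ) * diagonal d * ((g⁻¹ : (Matrix ι ι ℂ)ˣ) : Matrix ι ι ℂ)}) := by
  have hJψ : ∀ {T : Type} [CommRing T] [Algebra ℂ T] (ψ : MvPolynomial (ι × ι) ℂ →ₐ[ℂ] T),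
      ψ.mapMatrix Jp = J.map (algebraMap ℂ T) := fun ψ => by
    ext i j
    rw [hJp]
    exact ψ.commutes (J i j)
  have hrel : ∀ {T : Type} [CommRing T] [Algebra ℂ T] (ψ : MvPolynomial (ι × ι) ℂ →ₐ[ℂ] T),
      ψ.mapMatrix (A * Jp * Aᵀ - Jp) =
        ψ.mapMatrix A * J.map (algebraMap ℂ T) * (ψ.mapMatrix A)ᵀ - J.map (algebraMap ℂ T) :=
    fun ψ => by
      have : ψ.mapMatrix Aᵀ = (ψ.mapMatrix A)ᵀ := rfl
      rw [map_sub, map_mul, map_mul, hJψ, this]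
  have hpol : ∀ {T : Type} [CommRing T] [Algebra ℂ T] (ψ : MvPolynomial (ι × ι) ℂ →ₐ[ℂ] T),
      ψ.mapMatrix (aeval A (∏ z ∈ Λ, (X - C z))) = aeval (ψ.mapMatrix A) (∏ z ∈ Λ, (X - C z)) :=
    fun ψ => (aeval_algHom_apply ψ.mapMatrix A _).symm
  have htr : ∀ {T : Type} [CommRing T] [Algebra ℂ T] (ψ : MvPolynomial (ι × ι) ℂ →ₐ[ℂ] T) (k : ℕ),
      ψ (trace (A ^ k) - MvPolynomial.C (∑ i, d i ^ k)) =
        trace (ψ.mapMatrix A ^ k) - algebraMap ℂ T (∑ i, d i ^ k) := fun ψ k => by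
    have h1 : ψ (MvPolynomial.C (∑ i, d i ^ k)) = algebraMap ℂ _ (∑ i, d i ^ k) := ψ.commutes _
    rw [map_sub, h1, ← map_pow, AlgHom.mapMatrix_apply, trace, trace, map_sum]
    rfl
  have hJC : J.map (algebraMap ℂ ℂ) = J := by ext i j; simp
  apply le_antisymm
  · rw [Ideal.span_le]
    rintro f hf
    rw [SetLike.mem_coe, MvPolynomial.mem_vanishingIdeal_iff]
    rintro _ ⟨B, ⟨g, hg, rfl⟩, rfl⟩
    set B := (g : Matrix ι ι ℂ) * diagonal d * ((g⁻¹ : (Matrix ι ι ℂ)ˣ) : Matrix ι ι ℂ) with hB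
    set ψ : MvPolynomial (ι × ι) ℂ →ₐ[ℂ] ℂ := MvPolynomial.aeval fun q : ι × ι => B q.1 q.2 with hψ
    have hAB : ψ.mapMatrix A = B := by
      ext i j
      rw [hA]
      exact MvPolynomial.aeval_X _ _
    have hconj : ∀ P : ℂ[X], aeval B P =
        (g : Matrix ι ι ℂ) * diagonal (fun i => P.eval (d i)) *
          ((g⁻¹ : (Matrix ι ι ℂ)ˣ) : Matrix ι ι ℂ) := fun P => by
      induction P using Polynomial.induction_on' with
      | add p q hp hq =>
        rw [map_add, hp, hq, ← add_mul, ← mul_add, diagonal_add]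
        simp only [eval_add]
      | monomial k a =>
        rw [aeval_monomial, hB, Units.conj_pow, diagonal_pow, ← Algebra.smul_def,
          ← smul_mul_assoc, ← mul_smul_comm, ← diagonal_smul]
        simp only [eval_monomial]
        rfl
    rcases hf with (⟨q, rfl⟩ | ⟨q, rfl⟩) | ⟨r, rfl⟩
    · change ψ.mapMatrix (A * Jp * Aᵀ - Jp) q.1 q.2 = 0
      have hB1 : B * J * Bᵀ = J := by
        rw [← mul_sympAdj_eq_one_iff hJ] at hg ⊢
        have hg' : ((g⁻¹ : (Matrix ι ι ℂ)ˣ) : Matrix ι ι ℂ) = sympAdj J g := by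
          rw [← mul_one ((g⁻¹ : (Matrix ι ι ℂ)ˣ) : Matrix ι ι ℂ), ← hg, Units.inv_mul_cancel_left]
        rw [hB, hg', sympAdj_mul hJ, sympAdj_mul hJ, sympAdj_sympAdj hJ hJt]
        have hg2 := mul_eq_one_comm.1 hg
        calc (g : Matrix ι ι ℂ) * diagonal d * sympAdj J g *
              (g * (sympAdj J (diagonal d) * sympAdj J g))
            = g * (diagonal d * (sympAdj J g * g) * sympAdj J (diagonal d)) * sympAdj J g := by
              noncomm_ring
          _ = 1 := by rw [hg2, mul_one, hD, mul_one, hg]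
      rw [hrel, hAB, hJC, hB1, sub_self]
      rfl
    · change ψ.mapMatrix (aeval A (∏ z ∈ Λ, (X - C z))) q.1 q.2 = 0
      have : ∀ i, (∏ z ∈ Λ, (X - C z)).eval (d i) = 0 := fun i => by
        rw [eval_prod]
        exact Finset.prod_eq_zero (hd i) (by simp)
      simp [hpol, hAB, hconj, this]
    · change ψ _ = 0
      have h1 := hconj (X ^ ((r : ℕ) + 1))
      rw [map_pow, aeval_X] at h1
      rw [htr, hAB, h1, trace_mul_cycle, Units.inv_mul, one_mul]
      simp [trace]
  · intro f hf
    rw [MvPolynomial.mem_vanishingIdeal_iff] at hf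
    refine mem_of_forall_thickening fun S _ _ φ hφ ψ hψ => ?_
    have hψA : ψ f = MvPolynomial.aeval (fun q : ι × ι => ψ.mapMatrix A q.1 q.2) f := by
      rw [AlgHom.mapMatrix_apply, aeval_map, hA]
      congr 1
      exact (MvPolynomial.aeval_X_left_apply f).symm
    have hJS := algebraMap_mul_self (S := S) hJ
    rw [hψA]
    refine aeval_eq_zero_of_relations hJ hJt hD (fun g hg => ?_) hd (hN ▸ hcard) φ hφ ?_ ?_ ?_
    · refine hf _ ⟨_, ⟨⟨g, sympAdj J g, hg, mul_eq_one_comm.1 hg⟩,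
        (mul_sympAdj_eq_one_iff hJ g).1 hg, rfl⟩, rfl⟩
    · rw [mul_sympAdj_eq_one_iff hJS, ← sub_eq_zero, ← hrel]
      ext i j
      exact hψ _ (Ideal.subset_span (Or.inl (Or.inl ⟨(i, j), rfl⟩)))
    · rw [← hpol]
      ext i j
      exact hψ _ (Ideal.subset_span (Or.inl (Or.inr ⟨(i, j), rfl⟩)))
    · intro k hk hk'
      rw [← sub_eq_zero, ← htr]
      obtain ⟨k, rfl⟩ := Nat.exists_eq_add_of_le' hk
      exact hψ _ (Ideal.subset_span (Or.inr ⟨⟨k, by omega⟩, rfl⟩))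

end Assembly

end SpConj

/-- the defining ideal of a closed (non-Levi) conjugacy class of the
complex symplectic group `Sp(2n,ℂ)`: the ideal generated by the entries of
`A C Aᵀ − C`, the entries of the minimal polynomial
`(A−μ_1)⋯(A−μ_ℓ)(A+1)(A−1)(A−μ_ℓ⁻¹)⋯(A−μ_1⁻¹)`, and the trace relations
`Tr(A^k) = Σ n_i(μ_i^k + μ_i^{−k}) + 2m(−1)^k + 2p`, `k = 1,…,2n`, is the vanishing
ideal of the conjugacy class of the diagonal matrix `o` with entries
`(μ_1^{n_1},…,μ_ℓ^{n_ℓ},(−1)^m,1^{2p},(−1)^m,μ_ℓ^{-n_ℓ},…,μ_1^{-n_1})`. -/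
theorem sp_conjugacy_class_defining_ideal
    (n : ℕ) (hn : 1 ≤ n) (ℓ m p : ℕ) (hm : 1 ≤ m) (hp : 1 ≤ p)
    (nn : Fin ℓ → ℕ) (hnn : ∀ j, 0 < nn j)
    (μ : Fin ℓ → ℂ) (hμ0 : ∀ j, μ j ≠ 0) (hμ1 : ∀ j, μ j ^ 2 ≠ 1)
    (hμ : ∀ i j, i ≠ j → μ i ≠ μ j ∧ μ i ≠ (μ j)⁻¹)
    (hsum : (∑ j, nn j) + m + p = n) :
    let Cm : Matrix (Fin (2 * n)) (Fin (2 * n)) ℂ :=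
      Matrix.of fun i j =>
        if (i : ℕ) + (j : ℕ) = 2 * n - 1 then (if (i : ℕ) < n then 1 else -1) else 0
    let dlist : List ℂ :=
      ((List.ofFn fun j : Fin ℓ => List.replicate (nn j) (μ j)).flatten)
        ++ List.replicate m (-1) ++ List.replicate (2 * p) 1 ++ List.replicate m (-1)
        ++ (((List.ofFn fun j : Fin ℓ => List.replicate (nn j) (μ j)⁻¹).flatten).reverse)
    let o : Matrix (Fin (2 * n)) (Fin (2 * n)) ℂ :=
      Matrix.diagonal fun i => dlist.getD (i : ℕ) 0
    let O : Set (Matrix (Fin (2 * n)) (Fin (2 * n)) ℂ) :=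
      {B | ∃ g : (Matrix (Fin (2 * n)) (Fin (2 * n)) ℂ)ˣ,
        (g : Matrix (Fin (2 * n)) (Fin (2 * n)) ℂ) * Cm *
            ((g : Matrix (Fin (2 * n)) (Fin (2 * n)) ℂ))ᵀ = Cm ∧
        B = (g : Matrix (Fin (2 * n)) (Fin (2 * n)) ℂ) * o *
          ((g⁻¹ : (Matrix (Fin (2 * n)) (Fin (2 * n)) ℂ)ˣ) :
            Matrix (Fin (2 * n)) (Fin (2 * n)) ℂ)}
    let A : Matrix (Fin (2 * n)) (Fin (2 * n))
        (MvPolynomial (Fin (2 * n) × Fin (2 * n)) ℂ) :=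
      Matrix.of fun i j => MvPolynomial.X (i, j)
    let Cp : Matrix (Fin (2 * n)) (Fin (2 * n))
        (MvPolynomial (Fin (2 * n) × Fin (2 * n)) ℂ) := Cm.map MvPolynomial.C
    let FA : Matrix (Fin (2 * n)) (Fin (2 * n))
        (MvPolynomial (Fin (2 * n) × Fin (2 * n)) ℂ) :=
      ((List.ofFn fun j : Fin ℓ =>
          A - (MvPolynomial.C (μ j) : MvPolynomial (Fin (2 * n) × Fin (2 * n)) ℂ) • 1)
        ++ [A + 1, A - 1]
        ++ (List.ofFn fun j : Fin ℓ =>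
          A - (MvPolynomial.C (μ j)⁻¹ :
            MvPolynomial (Fin (2 * n) × Fin (2 * n)) ℂ) • 1).reverse).prod
    Ideal.span
        ((Set.range fun q : Fin (2 * n) × Fin (2 * n) =>
            (A * Cp * Aᵀ - Cp) q.1 q.2) ∪
          (Set.range fun q : Fin (2 * n) × Fin (2 * n) => FA q.1 q.2) ∪
          (Set.range fun r : Fin (2 * n) =>
            Matrix.trace (A ^ ((r : ℕ) + 1)) -
              MvPolynomial.C ((∑ j, (nn j : ℂ) *
                  (μ j ^ ((r : ℕ) + 1) + (μ j)⁻¹ ^ ((r : ℕ) + 1)))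
                + 2 * (m : ℂ) * (-1) ^ ((r : ℕ) + 1) + 2 * (p : ℂ))))
      = MvPolynomial.vanishingIdeal ℂ
          ((fun (B : Matrix (Fin (2 * n)) (Fin (2 * n)) ℂ)
              (q : Fin (2 * n) × Fin (2 * n)) => B q.1 q.2) '' O) := by
  intro Cm dlist o O A Cp FA
  subst hsum
  have hlen := SpConj.length_eigList m p nn μ
  have : Nonempty (Fin (2 * ((∑ j, nn j) + m + p))) := ⟨⟨0, by omega⟩⟩
  have hFA : FA = _ := (SpConj.aeval_prod_rootList (SpConj.nodup_rootList hμ1 hμ hμ0) A).symm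
  have key := SpConj.span_relations_eq_vanishingIdeal (SpConj.antidiag_mul_self _)
    (SpConj.transpose_antidiag _)
    (SpConj.diagonal_mul_sympAdj (SpConj.getD_mul_getD_rev hμ0 hlen))
    (Λ := (SpConj.rootList μ).toFinset)
    (fun i => by
      rw [List.getD_eq_getElem _ _ (hlen.symm ▸ i.2), List.mem_toFinset]
      exact SpConj.mem_rootList_of_mem_eigList m p nn μ (List.getElem_mem _))
    (Fintype.card_fin _) (SpConj.card_rootList_le hm hp hnn) A rfl Cp rfl
  simp only [SpConj.sum_getD _ hlen, SpConj.sum_pow_eigList] at key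
  rw [hFA]
  exact key
end
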